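/- arXiv:2503.00886 — 2 statements merged into one kernel-verified Lean document; each statement's English description precedes it below -/
import Mathlib

section
/- Let [a,b] be a segment with b > a and let m be a multisegment in good range for [a,b]. Then I^Lang_{[a,b]}(I_{[a]}(m)) = I_{[a]}(I^Lang_{[a,b]}(m)). -/
namespace Multiseg

/-- A segment `[a,b]` on a fixed cuspidal line, encoded by its endpoints. -/
abbrev Seg := ℤ × ℤ

/-- A multiset of pairs is a multisegment when each pair is a genuine segment. -/
def IsMS (m : Multiset Seg) : Prop := ∀ Δ ∈ m, Δ.1 ≤ Δ.2

/-- `Δ ≺ Δ'` : the segment `Δ` precedes `Δ'`. -/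
def Prec (Δ Δ' : Seg) : Prop := Δ.1 < Δ'.1 ∧ Δ.2 < Δ'.2 ∧ Δ'.1 ≤ Δ.2 + 1

instance : DecidableRel Prec := fun _ _ => by unfold Prec; infer_instance

/-- `Δ ⊆ Δ'` as segments. -/
def SSub (Δ Δ' : Seg) : Prop := Δ'.1 ≤ Δ.1 ∧ Δ.2 ≤ Δ'.2

/-- `m[i]`, the segments of `m` starting at `i`. -/
def startAt (m : Multiset Seg) (i : ℤ) : Multiset Seg := m.filter fun Δ => Δ.1 = i

/-- `m⟨i⟩`, the segments of `m` ending at `i`. -/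
def endAt (m : Multiset Seg) (i : ℤ) : Multiset Seg := m.filter fun Δ => Δ.2 = i

/-- `m_{[a,b]} = {[a',b'] ∈ m : a ≤ a' ≤ b+1 ≤ b'+1}`. -/
def mRange (m : Multiset Seg) (a b : ℤ) : Multiset Seg :=
  m.filter fun Δ => a ≤ Δ.1 ∧ Δ.1 ≤ b + 1 ∧ b ≤ Δ.2

/-- Add the segment `[x,y]` to `m`, discarding it if it is void. -/
def pushSeg (m : Multiset Seg) (x y : ℤ) : Multiset Seg :=
  if x ≤ y then m + {(x, y)} else m

def msetMax (s : Multiset ℤ) : Option ℤ :=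
  if h : s = 0 then none else some (s.toFinset.max' (Multiset.toFinset_nonempty.mpr h))

def msetMin (s : Multiset ℤ) : Option ℤ :=
  if h : s = 0 then none else some (s.toFinset.min' (Multiset.toFinset_nonempty.mpr h))

/-- The longest segment of `m[i]`, if any. -/
def longStart (m : Multiset Seg) (i : ℤ) : Option Seg :=
  (msetMax ((startAt m i).map Prod.snd)).map fun y => (i, y)

/-- The shortest segment of `m[i]`, if any. -/
def shortStart (m : Multiset Seg) (i : ℤ) : Option Seg :=
  (msetMin ((startAt m i).map Prod.snd)).map fun y => (i, y)

/-- The longest segment of `m⟨i⟩`, if any. -/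
def longEnd (m : Multiset Seg) (i : ℤ) : Option Seg :=
  (msetMin ((endAt m i).map Prod.fst)).map fun x => (x, i)

/-- The shortest segment of `m⟨i⟩`, if any. -/
def shortEnd (m : Multiset Seg) (i : ℤ) : Option Seg :=
  (msetMax ((endAt m i).map Prod.fst)).map fun x => (x, i)

/-- One removal step of the `tds(·,c)` process: remove the longest segment `Δ''`
of `m[c+1]` and the longest segment `Δ'` of `m[c]` with `Δ' ≺ Δ''`. -/
def tdsStep (m : Multiset Seg) (c : ℤ) : Option (Multiset Seg) :=
  match longStart m (c + 1) with
  | none => none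
  | some Δ'' =>
    match msetMax (((startAt m c).filter fun Δ => Prec Δ Δ'').map Prod.snd) with
    | none => none
    | some y => some ((m.erase (c, y)).erase Δ'')

def tdsIterF (c : ℤ) : ℕ → Multiset Seg → Multiset Seg
  | 0, m => m
  | n + 1, m =>
    match tdsStep m c with
    | none => m
    | some m' => tdsIterF c n m'

/-- Iterate the `tds(·,c)` process until it terminates. -/
def tdsIter (c : ℤ) (m : Multiset Seg) : Multiset Seg := tdsIterF c m.card m

/-- The `ρ`-derivative algorithm `𝒟_{[a]}`; the value `none` codes `∞`. -/
def Drho (a : ℤ) (m : Multiset Seg) : Option (Multiset Seg) :=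
  (shortStart (tdsIter a m) a).map fun Δ => pushSeg (m.erase Δ) (a + 1) Δ.2

/-- `ε_{[a]}(m)`, the number of segments starting at `a` left after the
`tds(·,a)` process terminates. -/
def epsA (a : ℤ) (m : Multiset Seg) : ℕ := (startAt (tdsIter a m) a).card

/-- The next element of an upward sequence after `p`. -/
def usNext (n : Multiset Seg) (p : Seg) : Option Seg :=
  match msetMin ((n.filter fun Δ => Prec p Δ).map Prod.fst) with
  | none => none
  | some aj =>
    (msetMax ((((n.filter fun Δ => Prec p Δ).filter fun Δ => Δ.1 = aj)).map Prod.snd)).map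
      fun y => (aj, y)

def usAux (n : Multiset Seg) : ℕ → Seg → List Seg
  | 0, _ => []
  | fuel + 1, p =>
    match usNext n p with
    | none => []
    | some Δ => Δ :: usAux n fuel Δ

/-- The upward sequence `Us(n)` of maximally linked segments of `n`. -/
def usList (n : Multiset Seg) : List Seg :=
  match msetMin (n.map Prod.fst) with
  | none => []
  | some a1 =>
    match longStart n a1 with
    | none => []
    | some Δ1 => Δ1 :: usAux n n.card Δ1

/-- The decomposition of a multisegment into successive upward sequences. -/
def usDecomp : ℕ → Multiset Seg → List (List Seg)
  | 0, _ => []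
  | fuel + 1, n =>
    if n = 0 then [] else usList n :: usDecomp fuel (n - (usList n : Multiset Seg))

/-- `[x,y] ⊆ [u,v]` (with the void interval contained in anything). -/
def intSubB (x y u v : ℤ) : Bool := decide (y < x) || (decide (u ≤ x) && decide (y ≤ v))

/-- Find, in a row of an upward-sequence decomposition, the first segment `Δ`
whose removable free section contains `[s(Δ), top]`. -/
def findRowD : List Seg → ℤ → Option Seg
  | [], _ => none
  | [Δ], top => if intSubB Δ.1 top Δ.1 Δ.2 then some Δ else none
  | Δ :: Δ' :: rest, top =>
    if intSubB Δ.1 top Δ.1 (Δ'.1 - 2) then some Δ else findRowD (Δ' :: rest) top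

/-- The selection step of the Langlands derivative algorithm, scanning the rows
downwards from the last one; it records each selected segment together with the
start of its truncation. -/
def selAuxD (rows : List (List Seg)) : ℕ → ℤ → List (Seg × ℤ)
  | 0, _ => []
  | n + 1, top =>
    match findRowD (rows.getD n []) top with
    | some Δ => (Δ, top + 1) :: selAuxD rows n (Δ.1 - 1)
    | none => selAuxD rows n top

/-- The Langlands derivative algorithm `𝒟^Lang_{[a,b]}`; `none` codes `∞`. -/
def DLang (a b : ℤ) (m : Multiset Seg) : Option (Multiset Seg) :=
  let m1 := mRange m a b
  let rows := usDecomp m1.card m1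
  let sel := selAuxD rows rows.length b
  match sel.getLast? with
  | none => none
  | some (Δl, _) =>
    if Δl.1 = a then
      some (sel.foldl (fun acc p => pushSeg (acc.erase p.1) p.2 p.1.2) m)
    else none

/-- One removal step of the `tus(·,c)` process. -/
def tusStep (n : Multiset Seg) (c : ℤ) : Option (Multiset Seg) :=
  match shortStart n c with
  | none => none
  | some Δ' =>
    match msetMin (((startAt n (c + 1)).filter fun Δ => Prec Δ' Δ).map Prod.snd) with
    | none => none
    | some y => some ((n.erase Δ').erase (c + 1, y))

def tusIterF (c : ℤ) : ℕ → Multiset Seg → Multiset Seg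
  | 0, n => n
  | k + 1, n =>
    match tusStep n c with
    | none => n
    | some n' => tusIterF c k n'

/-- Iterate the `tus(·,c)` process until it terminates. -/
def tusIter (c : ℤ) (n : Multiset Seg) : Multiset Seg := tusIterF c n.card n

/-- The `ρ`-integral algorithm `ℐ_{[a]}` (always defined). -/
def Irho (a : ℤ) (n : Multiset Seg) : Multiset Seg :=
  match longStart (tusIter a n) (a + 1) with
  | none => n + {(a, a)}
  | some Δ => pushSeg (n.erase Δ) a Δ.2

/-- The next element of a downward sequence after `p`. -/
def dsNext (n : Multiset Seg) (p : Seg) : Option Seg :=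
  match msetMax ((n.filter fun Δ => Prec Δ p).map Prod.fst) with
  | none => none
  | some aq => shortStart n aq

def dsAux (n : Multiset Seg) : ℕ → Seg → List Seg
  | 0, _ => []
  | k + 1, p =>
    match dsNext n p with
    | none => []
    | some Δ => Δ :: dsAux n k Δ

/-- The downward sequence `Ds(n)` of minimal linked segments with the largest
starting. -/
def dsList (n : Multiset Seg) : List Seg :=
  match msetMax (n.map Prod.fst) with
  | none => []
  | some a1 =>
    match shortStart n a1 with
    | none => []
    | some Δ1 => Δ1 :: dsAux n n.card Δ1

/-- The decomposition of a multisegment into successive downward sequences. -/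
def dsDecomp : ℕ → Multiset Seg → List (List Seg)
  | 0, _ => []
  | k + 1, n =>
    if n = 0 then [] else dsList n :: dsDecomp k (n - (dsList n : Multiset Seg))

/-- Find, in a row of a downward-sequence decomposition, the segment whose set
of addable free points contains `pt`. -/
def findRowI (a : ℤ) : List Seg → ℤ → Option Seg
  | [], _ => none
  | [Δ], pt => if decide (a ≤ pt) && decide (pt ≤ Δ.1 - 1) then some Δ else none
  | Δ :: Δ' :: rest, pt =>
    if decide (Δ'.1 + 1 ≤ pt) && decide (pt ≤ Δ.1 - 1) then some Δ
    else findRowI a (Δ' :: rest) pt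

/-- The selection step of the Langlands integral algorithm; it records each
selected segment together with the start of its extension. -/
def selAuxI (a : ℤ) (rows : List (List Seg)) : ℕ → ℤ → List (Seg × ℤ)
  | 0, _ => []
  | n + 1, pt =>
    match findRowI a (rows.getD n []) pt with
    | some Δ => (Δ, pt) :: selAuxI a rows n Δ.1
    | none => selAuxI a rows n pt

/-- The Langlands integral algorithm `ℐ^Lang_{[a,b]}`. -/
def ILang (a b : ℤ) (m : Multiset Seg) : Multiset Seg :=
  let m1 := mRange m a b
  let rows := dsDecomp m1.card m1
  let sel := selAuxI a rows rows.length a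
  let base := sel.foldl (fun acc p => pushSeg (acc.erase p.1) p.2 p.1.2) m
  match sel.getLast? with
  | none => pushSeg base a b
  | some (Δl, _) => pushSeg base Δl.1 b

/-- `m` is in good range for `[a,b]`. -/
def GoodRange (m : Multiset Seg) (a b : ℤ) : Prop := mRange m a b = m

/-- `Θ`, the Gelfand–Kazhdan involution on multisegments. -/
def Theta (m : Multiset Seg) : Multiset Seg := m.map fun Δ => (-Δ.2, -Δ.1)

/-- The exotic duality `𝔻_r`. -/
def Dual (r : ℤ) (m : Multiset Seg) : Multiset Seg :=
  m.map fun Δ => (-r + Δ.2 + 1, Δ.1 - 1)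

/-- `𝔻_r^{[a,b]}`. -/
def DualAB (r a b : ℤ) (m : Multiset Seg) : Multiset Seg := Dual r m + {(b - r + 1, b)}

/-- The left Langlands derivative algorithm `𝒟^{Lang,L}_{[a,b]}`. -/
def DLangL (a b : ℤ) (m : Multiset Seg) : Option (Multiset Seg) :=
  (DLang (-b) (-a) (Theta m)).map Theta

/-- The left `ρ`-derivative algorithm `𝒟^{Lang,L}_{[a]}`. -/
def DrhoL (a : ℤ) (m : Multiset Seg) : Option (Multiset Seg) :=
  (Drho (-a) (Theta m)).map Theta

/-- The next segment chosen by the MW algorithm after `p`. -/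
def mwNext (m : Multiset Seg) (p : Seg) : Option Seg :=
  (msetMax (((endAt m (p.2 - 1)).filter fun Δ => Prec Δ p).map Prod.fst)).map
    fun x => (x, p.2 - 1)

def mwAux (m : Multiset Seg) : ℕ → Seg → List Seg
  | 0, _ => []
  | k + 1, p =>
    match mwNext m p with
    | none => []
    | some Δ => Δ :: mwAux m k Δ

/-- The ordered segments participating in the MW algorithm for `m`. -/
def mwList (m : Multiset Seg) : List Seg :=
  match msetMax (m.map Prod.snd) with
  | none => []
  | some b0 =>
    match shortEnd m b0 with
    | none => []
    | some Δ0 => Δ0 :: mwAux m m.card Δ0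

/-- `𝒟^MW(m)`. -/
def DMW (m : Multiset Seg) : Multiset Seg :=
  (mwList m).foldl (fun acc Δ => pushSeg (acc.erase Δ) Δ.1 (Δ.2 - 1)) m

/-- The first segment `Δ(m)` produced by the MW algorithm for `m`. -/
def mwFirstSeg (m : Multiset Seg) : Option Seg :=
  match (mwList m).head?, (mwList m).getLast? with
  | some Δ0, some Δk => some (Δk.1, Δ0.2)
  | _, _ => none

/-- The total relative length of a multisegment. -/
def totalLen (m : Multiset Seg) : ℕ := (m.map fun Δ => (Δ.2 - Δ.1 + 1).toNat).sum

def sharpAux : ℕ → Multiset Seg → Multiset Seg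
  | 0, _ => 0
  | k + 1, m =>
    if m = 0 then 0
    else
      match mwFirstSeg m with
      | none => 0
      | some Δ => Δ ::ₘ sharpAux k (DMW m)

/-- The Mœglin–Waldspurger involution `m^#`. -/
def msharp (m : Multiset Seg) : Multiset Seg := sharpAux (totalLen m) m

/-- `ε^MW_{[a,c]}(m)`, the multiplicity of `[a,c]` in `m^#`. -/
def epsMW (a c : ℤ) (m : Multiset Seg) : ℕ := (msharp m).count (a, c)

/-- `m_i`: remove from `m` the participants of the first `i` runs of the MW
algorithm. -/
def mwStage (m : Multiset Seg) : ℕ → Multiset Seg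
  | 0 => m
  | i + 1 => mwStage m i - (mwList (DMW^[i] m) : Multiset Seg)

/-- `MW_k(m)`: all segments ending at `k` participating in the first `r` runs
of the MW algorithm. -/
def MWkSet (m : Multiset Seg) (r : ℕ) (k : ℤ) : Multiset Seg :=
  ∑ i ∈ Finset.range r, (mwList (DMW^[i] m) : Multiset Seg).filter fun Δ => Δ.2 = k

def upNbrAux (m : Multiset Seg) : ℕ → Seg → Option (List Seg)
  | 0, p => some [p]
  | k + 1, p =>
    match msetMin (((endAt m (p.2 + 1)).filter fun Δ => Prec p Δ).map Prod.fst) with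
    | none => none
    | some x => (upNbrAux m k (x, p.2 + 1)).map fun l => p :: l

/-- The removal upward sequence of maximal linked segments in neighbors on `m`
ranging from `a-1` to `b` (if it exists). -/
def upSeqNbr (m : Multiset Seg) (a b : ℤ) : Option (List Seg) :=
  match longEnd m (a - 1) with
  | none => none
  | some Δ => upNbrAux m (b - (a - 1)).toNat Δ

def zelRemF (a b : ℤ) : ℕ → Multiset Seg → Multiset Seg
  | 0, m => m
  | k + 1, m =>
    match upSeqNbr m a b with
    | none => m
    | some l => zelRemF a b k (m - (l : Multiset Seg))

/-- Repeatedly remove removal upward sequences of maximal linked segments in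
neighbors ranging from `a-1` to `b`, until none exists. -/
def zelRem (a b : ℤ) (m : Multiset Seg) : Multiset Seg := zelRemF a b m.card m

def zelRemCountF (a b : ℤ) : ℕ → Multiset Seg → ℕ
  | 0, _ => 0
  | k + 1, m =>
    match upSeqNbr m a b with
    | none => 0
    | some l => zelRemCountF a b k (m - (l : Multiset Seg)) + 1

/-- The number of removal upward sequences of maximal linked segments in
neighbors ranging from `a-1` to `b` successively removed from `m`. -/
def zelRemCount (a b : ℤ) (m : Multiset Seg) : ℕ := zelRemCountF a b m.card m

def downNbrAux (m : Multiset Seg) : ℕ → Seg → Option (List Seg)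
  | 0, p => some [p]
  | k + 1, p =>
    match msetMax (((endAt m (p.2 - 1)).filter fun Δ => Prec Δ p).map Prod.fst) with
    | none => none
    | some x => (downNbrAux m k (x, p.2 - 1)).map fun l => p :: l

/-- The Zelevinsky derivative algorithm `𝒟^Zel_{[a,b]}`; `none` codes `∞`. -/
def DZel (a b : ℤ) (m : Multiset Seg) : Option (Multiset Seg) :=
  match shortEnd (zelRem a b m) b with
  | none => none
  | some Δb =>
    match downNbrAux (zelRem a b m) (b - a).toNat Δb with
    | none => none
    | some l => some (l.foldl (fun acc Δ => pushSeg (acc.erase Δ) Δ.1 (Δ.2 - 1)) m)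

/-- The downward sequence of minimal linked segments in neighbors on `m`
ranging from `b` to `a-1` (if it exists). -/
def downSeqNbr (m : Multiset Seg) (a b : ℤ) : Option (List Seg) :=
  match shortEnd m b with
  | none => none
  | some Δ => downNbrAux m (b - (a - 1)).toNat Δ

def izRemF (a b : ℤ) : ℕ → Multiset Seg → Multiset Seg
  | 0, m => m
  | k + 1, m =>
    match downSeqNbr m a b with
    | none => m
    | some l => izRemF a b k (m - (l : Multiset Seg))

/-- Repeatedly remove downward sequences of minimal linked segments in
neighbors ranging from `b` to `a-1`, until none exists. -/
def izRem (a b : ℤ) (m : Multiset Seg) : Multiset Seg := izRemF a b m.card m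

def extNext (m : Multiset Seg) (p : Seg) : Option Seg :=
  (msetMin (((endAt m (p.2 + 1)).filter fun Δ => Prec p Δ).map Prod.fst)).map
    fun x => (x, p.2 + 1)

def extAux (m : Multiset Seg) : ℕ → Option Seg → List (Option Seg)
  | 0, _ => []
  | k + 1, p =>
    let cur := p.bind (extNext m)
    cur :: extAux m k cur

/-- The (possibly void) segments `Δ̃_{a-1}, …, Δ̃_{b-1}` participating in the
extension process of the Zelevinsky integral algorithm on `m`. -/
def extList (m : Multiset Seg) (a b : ℤ) : List (Option Seg) :=
  longEnd m (a - 1) :: extAux m (b - a).toNat (longEnd m (a - 1))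

def applyExt : Multiset Seg → ℤ → List (Option Seg) → Multiset Seg
  | acc, _, [] => acc
  | acc, i, some Δ :: rest => applyExt (pushSeg (acc.erase Δ) Δ.1 (Δ.2 + 1)) (i + 1) rest
  | acc, i, none :: rest => applyExt (acc + {(i + 1, i + 1)}) (i + 1) rest

/-- The Zelevinsky integral algorithm `ℐ^Zel_{[a,b]}`. -/
def IZel (a b : ℤ) (m : Multiset Seg) : Multiset Seg :=
  applyExt m (a - 1) (extList (izRem a b m) a b)

/-- `Δ̃⁺` for a possibly void `Δ̃` at position `i` (for the void segment at
position `i` this is the singleton `[i+1,i+1]`). -/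
def plusAt (i : ℤ) : Option Seg → Seg
  | some Δ => (Δ.1, Δ.2 + 1)
  | none => (i + 1, i + 1)

def plusList : ℤ → List (Option Seg) → List Seg
  | _, [] => []
  | i, o :: rest => plusAt i o :: plusList (i + 1) rest

/-- `n₁` and `n₂` are linked by mapping: there is an injective map `f : n₁ → n₂`
with `Δ ≺ f(Δ)` for all `Δ ∈ n₁`. -/
def LinkedByMapping (n₁ n₂ : Multiset Seg) : Prop :=
  ∃ n₂' ≤ n₂, Multiset.Rel Prec n₁ n₂'

def startsSorted (n : Multiset Seg) : List ℤ := (n.map Prod.fst).sort (· ≤ ·)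

/-- `n₁' < n₁` for multisegments of segments ending at a common point, compared
via their sorted lists of starting points. -/
def MSLtStarts (n₁' n₁ : Multiset Seg) : Prop :=
  startsSorted n₁' ≠ startsSorted n₁ ∧
    List.Forall₂ (· ≤ ·) (startsSorted n₁) (startsSorted n₁')

/-- `n₁ ⊆ m⟨k-1⟩` and `n₂ ⊆ m⟨k⟩` are minimally linked in `m`. -/
def MinLinked (m : Multiset Seg) (k : ℤ) (n₁ n₂ : Multiset Seg) : Prop :=
  n₁ ≤ endAt m (k - 1) ∧ n₂ ≤ endAt m k ∧ LinkedByMapping n₁ n₂ ∧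
    (∀ n₁' ≤ endAt m (k - 1), LinkedByMapping n₁' n₂ → n₁'.card ≤ n₁.card) ∧
    (∀ n₁' ≤ endAt m (k - 1), n₁'.card = n₁.card → MSLtStarts n₁' n₁ →
      ¬LinkedByMapping n₁' n₂)

/-- The non-free sections of a row of an upward-sequence decomposition. -/
def nfRow : List Seg → Multiset Seg
  | [] => 0
  | [_] => 0
  | Δ :: Δ' :: rest => pushSeg (nfRow (Δ' :: rest)) (Δ'.1 - 1) Δ.2

/-- `𝔡(m)`, the sum of all non-free sections. -/
def frakd (m : Multiset Seg) : Multiset Seg :=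
  (usDecomp m.card m).foldl (fun acc row => acc + nfRow row) 0

def DrhoPow (t : ℤ) : ℕ → Multiset Seg → Option (Multiset Seg)
  | 0, m => some m
  | k + 1, m => (Drho t m).bind (DrhoPow t k)

/-- `(𝒟_{[a+n-1]})^{ε_{a+n-1}} ∘ ⋯ ∘ (𝒟_{[a]})^{ε_a}(m)` where at each stage `t`
the exponent is `ε_t = ε_{[t]}` of the current multisegment; `none` codes that
some derivative in the composition is `∞`. -/
def hdComp : ℕ → ℤ → Multiset Seg → Option (Multiset Seg)
  | 0, _, m => some m
  | k + 1, t, m =>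
    match DrhoPow t (epsA t m) m with
    | none => none
    | some m' => hdComp k (t + 1) m'


def IsAM (f : ℤ → ℤ) (b X x : ℤ) : Prop :=
  b ≤ x ∧ x ≤ X ∧ (∀ s, b ≤ s → s ≤ X → f s ≤ f x) ∧ (∀ s, b ≤ s → s < x → f s < f x)

lemma exists_isAM (f : ℤ → ℤ) (b X : ℤ) (h : b ≤ X) : ∃ x, IsAM f b X x := by
  induction X, h using Int.leInduction with
  | base =>
    refine ⟨b, le_rfl, le_rfl, ?_, ?_⟩
    · intro s h1 h2
      have : s = b := by omega
      rw [this]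
    · intro s h1 h2; omega
  | succ X hX ih =>
    obtain ⟨x, h1, h2, h3, h4⟩ := ih
    by_cases hc : f x < f (X + 1)
    · refine ⟨X + 1, by omega, le_rfl, ?_, ?_⟩
      · intro s hs1 hs2
        rcases eq_or_lt_of_le hs2 with rfl | h
        · exact le_rfl
        · have := h3 s hs1 (by omega); omega
      · intro s hs1 hs2
        have := h3 s hs1 (by omega); omega
    · refine ⟨x, h1, by omega, ?_, h4⟩
      intro s hs1 hs2
      rcases eq_or_lt_of_le hs2 with rfl | h
      · omega
      · exact h3 s hs1 (by omega)

lemma IsAM.unique {f : ℤ → ℤ} {b X x y : ℤ} (hx : IsAM f b X x) (hy : IsAM f b X y) :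
    x = y := by
  obtain ⟨h1, h2, h3, h4⟩ := hx
  obtain ⟨k1, k2, k3, k4⟩ := hy
  by_contra hne
  rcases lt_or_gt_of_ne hne with h | h
  · have := k4 x h1 h
    have := h3 y k1 k2
    omega
  · have := h4 y k1 h
    have := k3 x h1 h2
    omega

open Classical in
noncomputable def am (f : ℤ → ℤ) (b X : ℤ) : ℤ :=
  if h : ∃ x, IsAM f b X x then h.choose else b

lemma am_spec (f : ℤ → ℤ) {b X : ℤ} (h : b ≤ X) : IsAM f b X (am f b X) := by
  have hh := exists_isAM f b X h
  unfold am
  rw [dif_pos hh]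
  exact hh.choose_spec

lemma am_eq {f : ℤ → ℤ} {b X x : ℤ} (h : IsAM f b X x) : am f b X = x :=
  (am_spec f (h.1.trans h.2.1)).unique h

/-! ### Column formula -/

/-- number of segments of `m` starting at `c` and ending at most at `t` -/
def cnt (m : Multiset Seg) (c t : ℤ) : ℤ :=
  ((m.filter fun Δ => Δ.1 = c ∧ Δ.2 ≤ t).card : ℤ)

lemma cnt_nonneg (m : Multiset Seg) (c t : ℤ) : 0 ≤ cnt m c t := by
  unfold cnt; positivity

lemma cnt_add (m n : Multiset Seg) (c t : ℤ) : cnt (m + n) c t = cnt m c t + cnt n c t := by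
  unfold cnt; simp

lemma cnt_singleton (p : Seg) (c t : ℤ) :
    cnt {p} c t = if p.1 = c ∧ p.2 ≤ t then 1 else 0 := by
  unfold cnt
  rw [Multiset.filter_singleton]
  split_ifs <;> simp

lemma cnt_pos {m : Multiset Seg} {c t : ℤ} (h : 0 < cnt m c t) :
    ∃ y, (c, y) ∈ m ∧ y ≤ t := by
  unfold cnt at h
  have h' : 0 < (m.filter fun Δ => Δ.1 = c ∧ Δ.2 ≤ t).card := by exact_mod_cast h
  obtain ⟨p, hp⟩ := Multiset.card_pos_iff_exists_mem.mp h'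
  rw [Multiset.mem_filter] at hp
  obtain ⟨h1, h2, h3⟩ := hp
  exact ⟨p.2, by rw [← h2]; exact h1, h3⟩

lemma cnt_zero {m : Multiset Seg} {c t : ℤ} (h : ∀ y, (c, y) ∈ m → t < y) :
    cnt m c t = 0 := by
  by_contra hne
  have := cnt_nonneg m c t
  obtain ⟨y, h1, h2⟩ := cnt_pos (m := m) (c := c) (t := t) (by omega)
  have := h y h1
  omega

lemma cnt_mono (m : Multiset Seg) (c : ℤ) {s t : ℤ} (h : s ≤ t) : cnt m c s ≤ cnt m c t := by
  unfold cnt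
  have := Multiset.card_le_card (Multiset.monotone_filter_right m
    (p := fun Δ => Δ.1 = c ∧ Δ.2 ≤ s) (q := fun Δ => Δ.1 = c ∧ Δ.2 ≤ t)
    (by intro Δ h1; exact ⟨h1.1, h1.2.trans h⟩))
  exact_mod_cast this

noncomputable def Hc (b : ℤ) (m : Multiset Seg) : ℕ → ℤ → ℤ → ℤ
  | 0, _, _ => 0
  | n + 1, c, t =>
    (fun s => Hc b m n (c + 1) s - cnt m c (s - 1))
      (am (fun s => Hc b m n (c + 1) s - cnt m c (s - 1)) b t) + cnt m c t

noncomputable def Ec (b : ℤ) (m : Multiset Seg) (n : ℕ) (c s : ℤ) : ℤ :=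
  Hc b m n (c + 1) s - cnt m c (s - 1)

lemma Hc_succ (b : ℤ) (m : Multiset Seg) (n : ℕ) (c t : ℤ) :
    Hc b m (n + 1) c t = Ec b m n c (am (Ec b m n c) b t) + cnt m c t := rfl

/-- point mass -/
def dl (p : Seg) : Seg → ℤ := fun q => if p = q then 1 else 0

noncomputable def Dl (b : ℤ) (m : Multiset Seg) : ℕ → ℤ → ℤ → Seg → ℤ
  | 0, c, _ => dl (c, b)
  | n + 1, c, X =>
    if Ec b m n c (am (Ec b m n c) b X) ≤ 0 then dl (c, b)
    else dl (c, am (Ec b m n c) b X) - dl (c + 1, am (Ec b m n c) b X)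
      + Dl b m n (c + 1) (am (Ec b m n c) b X)

noncomputable def Pt (b : ℤ) (m : Multiset Seg) : ℕ → ℤ → ℤ → ℤ
  | 0, c, _ => c
  | n + 1, c, X =>
    if Ec b m n c (am (Ec b m n c) b X) ≤ 0 then c
    else Pt b m n (c + 1) (am (Ec b m n c) b X)

lemma Dl_succ (b : ℤ) (m : Multiset Seg) (n : ℕ) (c X : ℤ) :
    Dl b m (n + 1) c X = if Ec b m n c (am (Ec b m n c) b X) ≤ 0 then dl (c, b)
    else dl (c, am (Ec b m n c) b X) - dl (c + 1, am (Ec b m n c) b X)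
      + Dl b m n (c + 1) (am (Ec b m n c) b X) := rfl

lemma Pt_succ (b : ℤ) (m : Multiset Seg) (n : ℕ) (c X : ℤ) :
    Pt b m (n + 1) c X = if Ec b m n c (am (Ec b m n c) b X) ≤ 0 then c
    else Pt b m n (c + 1) (am (Ec b m n c) b X) := rfl

def Rng (b : ℤ) (m : Multiset Seg) : Prop := ∀ Δ ∈ m, Δ.1 ≤ b + 1 ∧ b ≤ Δ.2

lemma cnt_below {b : ℤ} {m : Multiset Seg} (hR : Rng b m) (c t : ℤ) (ht : t < b) :
    cnt m c t = 0 := by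
  apply cnt_zero
  intro y hy
  have := (hR _ hy).2
  simp only at this
  omega

lemma Hc_nonneg {b : ℤ} {m : Multiset Seg} (hR : Rng b m) (n : ℕ) :
    ∀ c t, b ≤ t → 0 ≤ Hc b m n c t := by
  induction n with
  | zero => intro c t _; exact le_rfl
  | succ n ih =>
    intro c t ht
    rw [Hc_succ]
    obtain ⟨h1, h2, h3, h4⟩ := am_spec (Ec b m n c) ht
    have h5 := h3 b le_rfl ht
    have h6 := ih (c + 1) b le_rfl
    have h7 := cnt_below hR c (b - 1) (by omega)
    have h8 := cnt_nonneg m c t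
    have : Ec b m n c b = Hc b m n (c + 1) b - cnt m c (b - 1) := rfl
    omega

lemma Ec_b_nonneg {b : ℤ} {m : Multiset Seg} (hR : Rng b m) (n : ℕ) (c : ℤ) :
    0 ≤ Ec b m n c b := by
  have h6 := Hc_nonneg hR n (c + 1) b le_rfl
  have h7 := cnt_below hR c (b - 1) (by omega)
  unfold Ec
  omega

lemma Hc_pos {b : ℤ} {m : Multiset Seg} (n : ℕ) :
    ∀ c t, b ≤ t → 0 < Hc b m n c t → ∃ Δ ∈ m, c ≤ Δ.1 ∧ Δ.2 ≤ t := by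
  induction n with
  | zero => intro c t _ h; exact absurd h (lt_irrefl _)
  | succ n ih =>
    intro c t ht h
    rw [Hc_succ] at h
    obtain ⟨h1, h2, h3, h4⟩ := am_spec (Ec b m n c) ht
    have h8 := cnt_nonneg m c t
    by_cases hc : 0 < cnt m c t
    · obtain ⟨y, hy, hy'⟩ := cnt_pos hc
      exact ⟨_, hy, le_rfl, hy'⟩
    · have h9 := cnt_nonneg m c (am (Ec b m n c) b t - 1)
      have : Ec b m n c (am (Ec b m n c) b t) = Hc b m n (c + 1) (am (Ec b m n c) b t)
        - cnt m c (am (Ec b m n c) b t - 1) := rfl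
      obtain ⟨Δ, k1, k2, k3⟩ := ih (c + 1) _ h1 (by omega)
      exact ⟨Δ, k1, by omega, by omega⟩

/-- eager form -/
lemma Dl_b (b : ℤ) (m : Multiset Seg) (n : ℕ) : ∀ c, Dl b m n c b = dl (c, b) := by
  induction n with
  | zero => intro c; rfl
  | succ n ih =>
    intro c
    rw [Dl_succ]
    have hx : am (Ec b m n c) b b = b := by
      obtain ⟨h1, h2, -, -⟩ := am_spec (Ec b m n c) (le_refl b)
      omega
    rw [hx, ih]
    split_ifs
    · rfl
    · simp

lemma Dl_eager {b : ℤ} {m : Multiset Seg} (hR : Rng b m) (n : ℕ) (c X : ℤ) (hX : b ≤ X) :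
    Dl b m (n + 1) c X = dl (c, am (Ec b m n c) b X) - dl (c + 1, am (Ec b m n c) b X)
      + Dl b m n (c + 1) (am (Ec b m n c) b X) := by
  rw [Dl_succ]
  split_ifs with h
  · obtain ⟨h1, h2, h3, h4⟩ := am_spec (Ec b m n c) hX
    have hb := Ec_b_nonneg hR n c
    have : am (Ec b m n c) b X = b := by
      by_contra hne
      have := h4 b le_rfl (by omega)
      omega
    rw [this, Dl_b]
    simp
  · rfl

/-! ### Rows -/

/-- the records: members of the downward sequence -/
def IsRec (m : Multiset Seg) (Δ : Seg) : Prop :=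
  Δ ∈ m ∧ ∀ Δ' ∈ m, (Δ.1 < Δ'.1 → Δ.2 < Δ'.2) ∧ (Δ'.1 = Δ.1 → Δ.2 ≤ Δ'.2)

lemma IsRec.unique {m : Multiset Seg} {c y z : ℤ} (h : IsRec m (c, y)) (h' : IsRec m (c, z)) :
    y = z := by
  have h1 := (h.2 _ h'.1).2 rfl
  have h2 := (h'.2 _ h.1).2 rfl
  simp only at h1 h2
  omega

structure RowDec (m rest : Multiset Seg) (row : List Seg) : Prop where
  eq : m = (row : Multiset Seg) + rest
  mem : ∀ Δ, Δ ∈ row ↔ IsRec m Δ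
  sorted : row.Pairwise fun p q => q.1 < p.1

lemma RowDec.nodup {m rest : Multiset Seg} {row : List Seg} (h : RowDec m rest row) :
    row.Nodup := by
  refine h.sorted.imp ?_
  intro p q hpq he
  rw [he] at hpq
  exact lt_irrefl _ hpq

lemma RowDec.cnt_taken {m rest : Multiset Seg} {row : List Seg} (h : RowDec m rest row)
    {c y : ℤ} (hr : IsRec m (c, y)) (t : ℤ) :
    cnt m c t = cnt rest c t + if y ≤ t then 1 else 0 := by
  have h1 : cnt (row : Multiset Seg) c t = if y ≤ t then 1 else 0 := by
    split_ifs with hy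
    · have : (row : Multiset Seg).filter (fun Δ => Δ.1 = c ∧ Δ.2 ≤ t) = {(c, y)} := by
        rw [Multiset.Nodup.ext (Multiset.Nodup.filter _ (Multiset.coe_nodup.mpr h.nodup))
          (Multiset.nodup_singleton _)]
        rintro ⟨c', z⟩
        rw [Multiset.mem_filter, Multiset.mem_coe, h.mem, Multiset.mem_singleton]
        constructor
        · rintro ⟨h1, rfl, h3⟩
          rw [h1.unique hr]
        · intro he
          rw [he]
          exact ⟨hr, rfl, hy⟩
      unfold cnt
      rw [this]
      simp
    · apply cnt_zero
      intro z hz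
      rw [Multiset.mem_coe, h.mem] at hz
      rw [← hr.unique hz]
      omega
  conv_lhs => rw [h.eq]
  rw [cnt_add, h1, add_comm]

lemma RowDec.cnt_not {m rest : Multiset Seg} {row : List Seg} (h : RowDec m rest row)
    {c : ℤ} (hr : ∀ y, ¬ IsRec m (c, y)) (t : ℤ) :
    cnt m c t = cnt rest c t := by
  have h1 : cnt (row : Multiset Seg) c t = 0 := by
    apply cnt_zero
    intro z hz
    rw [Multiset.mem_coe, h.mem] at hz
    exact absurd hz (hr z)
  conv_lhs => rw [h.eq]
  rw [cnt_add, h1, zero_add]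

lemma RowDec.sub {m rest : Multiset Seg} {row : List Seg} (h : RowDec m rest row) :
    ∀ Δ ∈ rest, Δ ∈ m := by
  intro Δ hΔ
  rw [h.eq]
  exact Multiset.mem_add.mpr (Or.inr hΔ)

/-- existence of an element of minimal end satisfying a predicate -/
lemma exists_min {m : Multiset Seg} (P : Seg → Prop) (h : ∃ Δ ∈ m, P Δ) :
    ∃ Δ ∈ m, P Δ ∧ ∀ Δ' ∈ m, P Δ' → Δ.2 ≤ Δ'.2 := by
  classical
  obtain ⟨Δ, h1, h2⟩ := h
  have hne : (m.toFinset.filter P).Nonempty := ⟨Δ, by simp [h1, h2]⟩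
  obtain ⟨Δ0, k1, k2⟩ := Finset.exists_min_image _ (fun p : Seg => p.2) hne
  simp only [Finset.mem_filter, Multiset.mem_toFinset] at k1 k2
  exact ⟨Δ0, k1.1, k1.2, fun Δ' a1 a2 => k2 Δ' ⟨a1, a2⟩⟩

lemma not_taken {m : Multiset Seg} {c : ℤ} (hr : ∀ y, ¬ IsRec m (c, y)) :
    ∀ Δ ∈ m, c ≤ Δ.1 → ∃ Δ' ∈ m, c + 1 ≤ Δ'.1 ∧ Δ'.2 ≤ Δ.2 := by
  intro Δ hΔ hc
  by_cases h1 : c + 1 ≤ Δ.1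
  · exact ⟨Δ, hΔ, h1, le_rfl⟩
  obtain ⟨Δ0, k1, k2, k3⟩ := exists_min (fun p => p.1 = c) ⟨Δ, hΔ, by omega⟩
  have h2 := hr Δ0.2
  have e : (c, Δ0.2) = Δ0 := by rw [← k2]
  rw [e] at h2
  by_contra hcon
  push Not at hcon
  apply h2
  refine ⟨k1, fun Δ' hΔ' => ⟨fun hl => ?_, fun he => k3 Δ' hΔ' (by omega)⟩⟩
  have := hcon Δ' hΔ' (by omega)
  have := k3 Δ hΔ (by omega)
  omega

open Classical in
noncomputable def Kn (m : Multiset Seg) (c t : ℤ) : ℤ :=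
  if ∃ Δ ∈ m, c ≤ Δ.1 ∧ Δ.2 ≤ t then 1 else 0

lemma Kn_one {m : Multiset Seg} {c t : ℤ} (h : ∃ Δ ∈ m, c ≤ Δ.1 ∧ Δ.2 ≤ t) : Kn m c t = 1 :=
  if_pos h
lemma Kn_zero {m : Multiset Seg} {c t : ℤ} (h : ¬ ∃ Δ ∈ m, c ≤ Δ.1 ∧ Δ.2 ≤ t) :
    Kn m c t = 0 := if_neg h

lemma RowDec.H_eq {b : ℤ} {m rest : Multiset Seg} {row : List Seg} (h : RowDec m rest row)
    (hR : Rng b m) (n : ℕ) :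
    ∀ c t, c + n = b + 2 → b ≤ t → Hc b m n c t = Hc b rest n c t + Kn m c t := by
  have hRr : Rng b rest := fun Δ hΔ => hR Δ (h.sub Δ hΔ)
  induction n with
  | zero =>
    intro c t hc ht
    rw [Kn_zero]
    · rfl
    · rintro ⟨Δ, h1, h2, h3⟩
      have := (hR Δ h1).1
      push_cast at hc
      omega
  | succ n ih =>
    intro c t hc ht
    have ih' : ∀ s, b ≤ s → Hc b m n (c + 1) s = Hc b rest n (c + 1) s + Kn m (c + 1) s :=
      fun s hs => ih (c + 1) s (by push_cast at hc; omega) hs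
    rw [Hc_succ, Hc_succ]
    obtain ⟨h1, h2, h3, h4⟩ := am_spec (Ec b m n c) ht
    obtain ⟨k1, k2, k3, k4⟩ := am_spec (Ec b rest n c) ht
    set x := am (Ec b m n c) b t
    set xr := am (Ec b rest n c) b t
    have hEx : ∀ s, Ec b m n c s = Hc b m n (c + 1) s - cnt m c (s - 1) := fun s => rfl
    have hExr : ∀ s, Ec b rest n c s = Hc b rest n (c + 1) s - cnt rest c (s - 1) :=
      fun s => rfl
    have hpos : ∀ s, b ≤ s → 0 < Ec b rest n c s → Kn m (c + 1) s = 1 := by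
      intro s hs hp
      have := cnt_nonneg rest c (s - 1)
      obtain ⟨Δ, a1, a2, a3⟩ := Hc_pos n (c + 1) s hs
        (by rw [hExr] at hp; omega : 0 < Hc b rest n (c + 1) s)
      exact Kn_one ⟨Δ, h.sub Δ a1, a2, a3⟩
    have hb := Ec_b_nonneg hR n c
    have hbr := Ec_b_nonneg hRr n c
    by_cases htk : ∃ y, IsRec m (c, y)
    · obtain ⟨y, hy⟩ := htk
      have hK : Kn m c t = if y ≤ t then 1 else 0 := by
        split_ifs with hyt
        · exact Kn_one ⟨_, hy.1, le_rfl, hyt⟩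
        · apply Kn_zero
          rintro ⟨Δ, a1, a2, a3⟩
          have := hy.2 Δ a1
          simp only at this
          rcases eq_or_lt_of_le a2 with e | e
          · have := this.2 e.symm; omega
          · have := this.1 e; omega
      have hK1 : ∀ s, s ≤ y → Kn m (c + 1) s = 0 := by
        intro s hs
        apply Kn_zero
        rintro ⟨Δ, a1, a2, a3⟩
        have := (hy.2 Δ a1).1 (by simp only; omega)
        simp only at this
        omega
      have hK2 : ∀ s, Kn m (c + 1) s = 0 ∨ Kn m (c + 1) s = 1 := by
        intro s; unfold Kn; split_ifs <;> simp
      have hEE : ∀ s, b ≤ s → Ec b m n c s = Ec b rest n c s + Kn m (c + 1) s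
          - if y ≤ s - 1 then 1 else 0 := by
        intro s hs
        rw [hEx, hExr, ih' s hs, h.cnt_taken hy]
        ring
      have hmax : Ec b m n c x = Ec b rest n c xr := by
        apply le_antisymm
        · have e1 := hEE x h1
          have e2 := k3 x h1 h2
          have e3 := hK1 x
          have e4 := hK2 x
          split_ifs at e1 <;> omega
        · have e1 := hEE xr k1
          have e2 := h3 xr k1 k2
          have e3 := hpos xr k1
          have e4 := hK2 xr
          have e5 := h3 b le_rfl ht
          split_ifs at e1 <;> omega
      rw [hmax, h.cnt_taken hy, hK]
      ring
    · push Not at htk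
      have hnt := not_taken htk
      have hEE : ∀ s, b ≤ s → Ec b m n c s = Ec b rest n c s + Kn m (c + 1) s := by
        intro s hs
        rw [hEx, hExr, ih' s hs, h.cnt_not htk]
        ring
      rw [h.cnt_not htk]
      by_cases hk : ∃ Δ ∈ m, c ≤ Δ.1 ∧ Δ.2 ≤ t
      · rw [Kn_one hk]
        have hk' : ∃ Δ ∈ m, c + 1 ≤ Δ.1 := by
          obtain ⟨Δ, a1, a2, a3⟩ := hk
          obtain ⟨Δ', e1, e2, e3⟩ := hnt Δ a1 a2
          exact ⟨Δ', e1, e2⟩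
        obtain ⟨Δ0, g1, g2, g3⟩ := exists_min (fun p => c + 1 ≤ p.1) hk'
        have g4 : Δ0.2 ≤ t := by
          obtain ⟨Δ, a1, a2, a3⟩ := hk
          obtain ⟨Δ', e1, e2, e3⟩ := hnt Δ a1 a2
          have := g3 Δ' e1 e2
          omega
        have g5 := (hR Δ0 g1).2
        have g6 : cnt m c (Δ0.2 - 1) = 0 := by
          apply cnt_zero
          intro y hy
          obtain ⟨Δ', e1, e2, e3⟩ := hnt _ hy le_rfl
          have := g3 Δ' e1 e2
          simp only at e3
          omega
        have g7 := Hc_nonneg hRr n (c + 1) Δ0.2 g5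
        have g8 := ih' Δ0.2 g5
        rw [Kn_one ⟨Δ0, g1, g2, le_rfl⟩] at g8
        have g9 := h3 Δ0.2 g5 g4
        have g10 := hEx Δ0.2
        have : Ec b m n c x = Ec b rest n c xr + 1 := by
          apply le_antisymm
          · have e1 := hEE x h1
            have e2 := k3 x h1 h2
            have e4 : Kn m (c + 1) x ≤ 1 := by unfold Kn; split_ifs <;> simp
            omega
          · have e1 := hEE xr k1
            have e2 := h3 xr k1 k2
            have e3 := hpos xr k1
            by_cases hp : 0 < Ec b rest n c xr
            · have := e3 hp; omega
            · omega
        omega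
      · rw [Kn_zero hk]
        have hK : ∀ s, s ≤ t → Kn m (c + 1) s = 0 := by
          intro s hs
          apply Kn_zero
          rintro ⟨Δ, a1, a2, a3⟩
          exact hk ⟨Δ, a1, by omega, by omega⟩
        have e1 := hEE x h1
        have e2 := hEE xr k1
        have e3 := h3 xr k1 k2
        have e4 := k3 x h1 h2
        have e5 := hK x h2
        have e6 := hK xr k2
        omega

lemma exists_min_of {m : Multiset Seg} (f : Seg → ℤ) (P : Seg → Prop) (h : ∃ Δ ∈ m, P Δ) :
    ∃ Δ ∈ m, P Δ ∧ ∀ Δ' ∈ m, P Δ' → f Δ ≤ f Δ' := by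
  classical
  obtain ⟨Δ, h1, h2⟩ := h
  have hne : (m.toFinset.filter P).Nonempty := ⟨Δ, by simp [h1, h2]⟩
  obtain ⟨Δ0, k1, k2⟩ := Finset.exists_min_image _ f hne
  simp only [Finset.mem_filter, Multiset.mem_toFinset] at k1 k2
  exact ⟨Δ0, k1.1, k1.2, fun Δ' a1 a2 => k2 Δ' ⟨a1, a2⟩⟩

lemma rec_below {m : Multiset Seg} {c t : ℤ} (h : ∃ Δ ∈ m, c ≤ Δ.1 ∧ Δ.2 ≤ t) :
    ∃ Δ, IsRec m Δ ∧ c ≤ Δ.1 ∧ Δ.2 ≤ t := by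
  obtain ⟨Δ, h1, h2, h3⟩ := h
  obtain ⟨p, p1, p2, p3⟩ := exists_min_of (fun q => q.2) (fun q => c ≤ q.1) ⟨Δ, h1, h2⟩
  obtain ⟨q, q1, q2, q3⟩ := exists_min_of (fun q => - q.1) (fun q => c ≤ q.1 ∧ q.2 = p.2)
    ⟨p, p1, p2, rfl⟩
  have := p3 Δ h1 h2
  refine ⟨q, ⟨q1, fun r hr => ⟨fun hl => ?_, fun he => ?_⟩⟩, q2.1, by omega⟩
  · have k1 := p3 r hr (by omega)
    by_contra hcon
    have := q3 r hr ⟨by omega, by omega⟩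
    omega
  · have k1 := p3 r hr (by omega)
    omega

/-- `Δ` is the segment of the row selected for the point `pt`. -/
def IsNext (m : Multiset Seg) (pt : ℤ) (Δ : Seg) : Prop :=
  IsRec m Δ ∧ pt < Δ.1 ∧ ∀ Δ', IsRec m Δ' → Δ'.1 < Δ.1 → Δ'.1 < pt

lemma exists_next {m : Multiset Seg} {c : ℤ} (hr : ∀ y, ¬ IsRec m (c, y))
    (h : ∃ Δ ∈ m, c ≤ Δ.1) : ∃ Δ, IsNext m c Δ := by
  obtain ⟨Δ, h1, h2⟩ := h
  obtain ⟨p, p1, p2, p3⟩ := rec_below (t := Δ.2) ⟨Δ, h1, h2, le_rfl⟩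
  obtain ⟨q, q1, q2, q3⟩ := exists_min_of (fun q => q.1) (fun q => c ≤ q.1 ∧ IsRec m q)
    ⟨p, p1.1, p2, p1⟩
  refine ⟨q, q2.2, ?_, fun r hrr hl => ?_⟩
  · rcases eq_or_lt_of_le q2.1 with e | e
    · exact absurd (by rw [e]; exact q2.2) (hr q.2)
    · exact e
  · by_contra hcon
    have := q3 r hrr.1 ⟨by omega, hrr⟩
    omega

/-- the next record realizes the minimum of the ends -/
lemma rec_min {m : Multiset Seg} {c : ℤ} {Δ : Seg} (h1 : IsRec m Δ)
    (h3 : ∀ Δ', IsRec m Δ' → Δ'.1 < Δ.1 → Δ'.1 < c) :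
    ∀ Δ' ∈ m, c ≤ Δ'.1 → Δ.2 ≤ Δ'.2 := by
  intro r hr hc
  by_contra hcon
  obtain ⟨p, p1, p2, p3⟩ := rec_below (t := r.2) ⟨r, hr, hc, le_rfl⟩
  by_cases hl : p.1 < Δ.1
  · have := h3 p p1 hl; omega
  · have := h1.2 p p1.1
    rcases eq_or_lt_of_le (not_lt.mp hl) with e | e
    · have := this.2 e.symm; omega
    · have := this.1 e; omega

lemma RowDec.chain {b : ℤ} {m rest : Multiset Seg} {row : List Seg} (h : RowDec m rest row)
    (hR : Rng b m) {Δ : Seg} (hΔ : IsRec m Δ) (n : ℕ) :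
    ∀ c, c + n = b + 2 → c ≤ Δ.1 → (∀ Δ', IsRec m Δ' → Δ'.1 < Δ.1 → Δ'.1 < c) →
      Dl b m n c Δ.2 = dl (c, Δ.2) - dl Δ + dl (Δ.1, b) ∧ Pt b m n c Δ.2 = Δ.1 := by
  have hRr : Rng b rest := fun Δ hΔ => hR Δ (h.sub Δ hΔ)
  have hΔb := hR Δ hΔ.1
  induction n with
  | zero =>
    intro c hc hle _
    push_cast at hc
    omega
  | succ n ih =>
    intro c hc hle hno
    have hmin := rec_min hΔ hno
    rcases eq_or_lt_of_le hle with e | e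
    · have hE : Ec b m n c (am (Ec b m n c) b Δ.2) ≤ 0 := by
        obtain ⟨h1, h2, h3, h4⟩ := am_spec (Ec b m n c) hΔb.2
        by_contra hcon
        have k1 := cnt_nonneg m c (am (Ec b m n c) b Δ.2 - 1)
        have k2 : Ec b m n c (am (Ec b m n c) b Δ.2) = Hc b m n (c + 1) (am (Ec b m n c) b Δ.2)
          - cnt m c (am (Ec b m n c) b Δ.2 - 1) := rfl
        obtain ⟨p, p1, p2, p3⟩ := Hc_pos n (c + 1) _ h1
          (by omega : 0 < Hc b m n (c + 1) (am (Ec b m n c) b Δ.2))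
        have := (hΔ.2 p p1).1 (by omega)
        omega
      rw [Dl_succ, Pt_succ, if_pos hE, if_pos hE, e]
      exact ⟨by simp, rfl⟩
    · have hnt : ∀ y, ¬ IsRec m (c, y) := by
        intro y hy
        have := hno _ hy e
        simp only at this
        omega
      have hk : Hc b m n (c + 1) Δ.2 = Hc b rest n (c + 1) Δ.2 + 1 := by
        rw [h.H_eq hR n (c + 1) Δ.2 (by push_cast at hc; omega) hΔb.2,
          Kn_one ⟨Δ, hΔ.1, by omega, le_rfl⟩]
      have hk0 := Hc_nonneg hRr n (c + 1) Δ.2 hΔb.2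
      have hc0 : cnt m c (Δ.2 - 1) = 0 := by
        apply cnt_zero
        intro y hy
        have := hmin _ hy le_rfl
        simp only at this
        omega
      have hEk : 0 < Ec b m n c Δ.2 := by unfold Ec; omega
      have hlow : ∀ s, b ≤ s → s < Δ.2 → Ec b m n c s ≤ 0 := by
        intro s hs hs'
        by_contra hcon
        have k1 := cnt_nonneg m c (s - 1)
        obtain ⟨p, p1, p2, p3⟩ := Hc_pos n (c + 1) s hs
          (by unfold Ec at hcon; omega : 0 < Hc b m n (c + 1) s)
        have := hmin p p1 (by omega)
        omega
      have ham : am (Ec b m n c) b Δ.2 = Δ.2 := by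
        apply am_eq
        refine ⟨hΔb.2, le_rfl, ?_, ?_⟩
        · intro s hs hs'
          rcases eq_or_lt_of_le hs' with e' | e'
          · rw [e']
          · have := hlow s hs e'; omega
        · intro s hs hs'
          have := hlow s hs hs'; omega
      have hrec := ih (c + 1) (by push_cast at hc; omega) (by omega)
        (fun Δ' a1 a2 => by have := hno Δ' a1 a2; omega)
      rw [Dl_succ, Pt_succ, ham, if_neg (by omega), if_neg (by omega), hrec.1, hrec.2]
      exact ⟨by abel, rfl⟩

lemma RowDec.step {b : ℤ} {m rest : Multiset Seg} {row : List Seg} (h : RowDec m rest row)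
    (hR : Rng b m) (n : ℕ) :
    ∀ c X, c + n = b + 2 → b ≤ X →
      ((∃ Δ ∈ m, c ≤ Δ.1) → ∃ Δ ∈ m, c ≤ Δ.1 ∧ Δ.2 ≤ X) →
      (∀ Δ, IsNext m (Pt b rest n c X) Δ →
        Dl b m n c X = Dl b rest n c X - dl (Pt b rest n c X, b) + dl (Pt b rest n c X, Δ.2)
          - dl Δ + dl (Δ.1, b) ∧ Pt b m n c X = Δ.1) ∧
      ((¬ ∃ Δ, IsNext m (Pt b rest n c X) Δ) →
        Dl b m n c X = Dl b rest n c X ∧ Pt b m n c X = Pt b rest n c X) := by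
  have hRr : Rng b rest := fun Δ hΔ => hR Δ (h.sub Δ hΔ)
  induction n with
  | zero =>
    intro c X hc hX hg
    refine ⟨?_, fun _ => ⟨rfl, rfl⟩⟩
    rintro Δ ⟨h1, h2, h3⟩
    have := (hR Δ h1.1).1
    change c < Δ.1 at h2
    push_cast at hc
    omega
  | succ n ih =>
    intro c X hc hX hg
    have hc' : c + 1 + (n : ℤ) = b + 2 := by push_cast at hc; omega
    have hH : ∀ s, b ≤ s → Hc b m n (c + 1) s = Hc b rest n (c + 1) s + Kn m (c + 1) s :=
      fun s hs => h.H_eq hR n (c + 1) s hc' hs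
    have hEx : ∀ s, Ec b m n c s = Hc b m n (c + 1) s - cnt m c (s - 1) := fun s => rfl
    have hExr : ∀ s, Ec b rest n c s = Hc b rest n (c + 1) s - cnt rest c (s - 1) :=
      fun s => rfl
    have hpos0 : ∀ s, b ≤ s → 0 < Ec b rest n c s → ∃ Δ ∈ m, c + 1 ≤ Δ.1 ∧ Δ.2 ≤ s := by
      intro s hs hp
      have := cnt_nonneg rest c (s - 1)
      obtain ⟨Δ, a1, a2, a3⟩ := Hc_pos n (c + 1) s hs
        (by rw [hExr] at hp; omega : 0 < Hc b rest n (c + 1) s)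
      exact ⟨Δ, h.sub Δ a1, a2, a3⟩
    have hK2 : ∀ s, Kn m (c + 1) s = 0 ∨ Kn m (c + 1) s = 1 := by
      intro s; unfold Kn; split_ifs <;> simp
    have hKmono : ∀ s t, s ≤ t → Kn m (c + 1) s = 1 → Kn m (c + 1) t = 1 := by
      intro s t hst hs
      by_cases hh : ∃ Δ ∈ m, c + 1 ≤ Δ.1 ∧ Δ.2 ≤ s
      · obtain ⟨Δ, a1, a2, a3⟩ := hh
        exact Kn_one ⟨Δ, a1, a2, by omega⟩
      · rw [Kn_zero hh] at hs; omega
    obtain ⟨k1, k2, k3, k4⟩ := am_spec (Ec b rest n c) hX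
    -- comparison of `Ec`
    have hcomp : (∀ s, b ≤ s → Ec b m n c s ≤ Ec b rest n c s + Kn m (c + 1) s) ∧
        (∀ s, b ≤ s → Kn m (c + 1) s = 0 → Ec b m n c s ≤ Ec b rest n c s) ∧
        ((∀ s, b ≤ s → Kn m (c + 1) s = 1 → Ec b m n c s = Ec b rest n c s) ∨
         (∀ s, b ≤ s → Kn m (c + 1) s = 1 → Ec b m n c s = Ec b rest n c s + 1)) := by
      by_cases htk : ∃ y, IsRec m (c, y)
      · obtain ⟨y, hy⟩ := htk
        have hEE : ∀ s, b ≤ s → Ec b m n c s = Ec b rest n c s + Kn m (c + 1) s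
            - if y ≤ s - 1 then 1 else 0 := by
          intro s hs
          rw [hEx, hExr, hH s hs, h.cnt_taken hy]
          ring
        refine ⟨?_, ?_, Or.inl ?_⟩
        · intro s hs
          have := hEE s hs
          split_ifs at this <;> omega
        · intro s hs _
          have := hEE s hs
          split_ifs at this <;> omega
        · intro s hs hk
          have := hEE s hs
          have hys : y ≤ s - 1 := by
            by_contra hcon
            rw [Kn_zero] at hk
            · omega
            · rintro ⟨Δ, a1, a2, a3⟩
              have := (hy.2 Δ a1).1 (by simp only; omega)
              simp only at this
              omega
          rw [if_pos hys] at this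
          omega
      · push Not at htk
        have hEE : ∀ s, b ≤ s → Ec b m n c s = Ec b rest n c s + Kn m (c + 1) s := by
          intro s hs
          rw [hEx, hExr, hH s hs, h.cnt_not htk]
          ring
        refine ⟨fun s hs => (hEE s hs).le, fun s hs hk => by rw [hEE s hs, hk, add_zero],
          Or.inr fun s hs hk => by rw [hEE s hs, hk]⟩
    by_cases hp : 0 < Ec b rest n c (am (Ec b rest n c) b X)
    · -- the point moves on in `rest`
      set x := am (Ec b rest n c) b X with hx
      have hKx := hpos0 x k1 hp
      have hKx1 : Kn m (c + 1) x = 1 := Kn_one hKx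
      obtain ⟨g1, g2, g3⟩ := hcomp
      have hEm : 0 < Ec b m n c x ∧ am (Ec b m n c) b X = x := by
        have hlow : ∀ s, b ≤ s → Kn m (c + 1) s = 0 → Ec b m n c s ≤ 0 := by
          intro s hs hk
          have := g2 s hs hk
          by_contra hcon
          have := Kn_one (hpos0 s hs (by omega))
          omega
        rcases g3 with g3 | g3
        · have e1 := g3 x k1 hKx1
          refine ⟨by omega, am_eq ⟨k1, k2, ?_, ?_⟩⟩
          · intro s hs hs'
            have e2 := k3 s hs hs'
            rcases hK2 s with e | e
            · have := hlow s hs e; omega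
            · have := g3 s hs e; omega
          · intro s hs hs'
            have e2 := k4 s hs hs'
            rcases hK2 s with e | e
            · have := hlow s hs e; omega
            · have := g3 s hs e; omega
        · have e1 := g3 x k1 hKx1
          refine ⟨by omega, am_eq ⟨k1, k2, ?_, ?_⟩⟩
          · intro s hs hs'
            have e2 := k3 s hs hs'
            rcases hK2 s with e | e
            · have := hlow s hs e; omega
            · have := g3 s hs e; omega
          · intro s hs hs'
            have e2 := k4 s hs hs'
            rcases hK2 s with e | e
            · have := hlow s hs e; omega
            · have := g3 s hs e; omega
      have hi := ih (c + 1) x hc' k1 (fun _ => hKx)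
      rw [Dl_succ, Dl_succ, Pt_succ, Pt_succ, hEm.2, ← hx, if_neg (by omega), if_neg (by omega),
        if_neg (by omega), if_neg (by omega)]
      refine ⟨fun Δ hΔ => ?_, fun hno => ?_⟩
      · have := hi.1 Δ hΔ
        rw [this.1, this.2]
        exact ⟨by abel, rfl⟩
      · have := hi.2 hno
        rw [this.1, this.2]
        exact ⟨rfl, rfl⟩
    · have hall : ∀ s, b ≤ s → s ≤ X → Ec b rest n c s ≤ 0 := by
        intro s hs hs'
        have := k3 s hs hs'
        omega
      rw [Dl_succ b rest, Pt_succ b rest, if_pos (not_lt.mp hp), if_pos (not_lt.mp hp)]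
      obtain ⟨j1, j2, j3, j4⟩ := am_spec (Ec b m n c) hX
      by_cases htk : ∃ y, IsRec m (c, y)
      · obtain ⟨y, hy⟩ := htk
        have hno : ¬ ∃ Δ, IsNext m c Δ := by
          rintro ⟨Δ, a1, a2, a3⟩
          have := a3 _ hy a2
          simp only at this
          omega
        refine ⟨fun Δ hΔ => absurd ⟨Δ, hΔ⟩ hno, fun _ => ?_⟩
        have hE : Ec b m n c (am (Ec b m n c) b X) ≤ 0 := by
          have e1 := hall _ j1 j2
          have e2 : Ec b m n c (am (Ec b m n c) b X) =
            Ec b rest n c (am (Ec b m n c) b X) + Kn m (c + 1) (am (Ec b m n c) b X)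
            - if y ≤ (am (Ec b m n c) b X) - 1 then 1 else 0 := by
            rw [hEx, hExr, hH _ j1, h.cnt_taken hy]
            ring
          have e3 := hcomp.2.1 _ j1
          rcases hK2 (am (Ec b m n c) b X) with e | e
          · have := e3 e; omega
          · have hys : y ≤ (am (Ec b m n c) b X) - 1 := by
              by_contra hcon
              rw [Kn_zero] at e
              · omega
              · rintro ⟨Δ, a1, a2, a3⟩
                have := (hy.2 Δ a1).1 (by simp only; omega)
                simp only at this
                omega
            rw [if_pos hys] at e2
            omega
        rw [Dl_succ, Pt_succ, if_pos hE, if_pos hE]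
        exact ⟨rfl, rfl⟩
      · push Not at htk
        by_cases hex : ∃ Δ ∈ m, c ≤ Δ.1
        · obtain ⟨Δ, hΔ⟩ := exists_next htk hex
          have huniq : ∀ Δ', IsNext m c Δ' → Δ' = Δ := by
            intro Δ' hΔ'
            have e1 : Δ'.1 = Δ.1 := by
              by_contra hne
              rcases lt_or_gt_of_ne hne with e | e
              · have := hΔ.2.2 Δ' hΔ'.1 e
                have := hΔ'.2.1
                omega
              · have := hΔ'.2.2 Δ hΔ.1 e
                have := hΔ.2.1
                omega
            have e2 : Δ'.2 = Δ.2 := by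
              have h1 : IsRec m (Δ.1, Δ'.2) := by rw [← e1]; exact hΔ'.1
              exact h1.unique hΔ.1
            exact Prod.ext e1 e2
          refine ⟨fun Δ' hΔ' => ?_, fun hno => absurd ⟨Δ, hΔ⟩ hno⟩
          rw [huniq Δ' hΔ']
          have hmin := rec_min hΔ.1 hΔ.2.2
          have hΔX : Δ.2 ≤ X := by
            obtain ⟨r, r1, r2, r3⟩ := hg hex
            have := hmin r r1 r2
            omega
          have hΔb := (hR Δ hΔ.1.1).2
          have hEE : ∀ s, b ≤ s → Ec b m n c s = Ec b rest n c s + Kn m (c + 1) s := by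
            intro s hs
            rw [hEx, hExr, hH s hs, h.cnt_not htk]
            ring
          have hKΔ : Kn m (c + 1) Δ.2 = 1 := Kn_one ⟨Δ, hΔ.1.1, by have := hΔ.2.1; omega, le_rfl⟩
          have hKl : ∀ s, s < Δ.2 → Kn m (c + 1) s = 0 := by
            intro s hs
            apply Kn_zero
            rintro ⟨r, r1, r2, r3⟩
            have := hmin r r1 (by omega)
            omega
          have hc0 : cnt rest c (Δ.2 - 1) = 0 := by
            apply cnt_zero
            intro y hy
            have := hmin _ (h.sub _ hy) le_rfl
            simp only at this
            omega
          have hr0 : 0 ≤ Ec b rest n c Δ.2 := by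
            have := Hc_nonneg hRr n (c + 1) Δ.2 hΔb
            rw [hExr]
            omega
          have hEΔ : Ec b m n c Δ.2 = 1 := by
            have := hEE Δ.2 hΔb
            have := hall Δ.2 hΔb hΔX
            omega
          have ham : am (Ec b m n c) b X = Δ.2 := by
            apply am_eq
            refine ⟨hΔb, hΔX, ?_, ?_⟩
            · intro s hs hs'
              have := hEE s hs
              have := hall s hs hs'
              have := hK2 s
              omega
            · intro s hs hs'
              have := hEE s hs
              have := hall s hs (by omega)
              have := hKl s hs'
              omega
          have hch := h.chain hR hΔ.1 n (c + 1) hc' (by have := hΔ.2.1; omega)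
            (fun Δ' a1 a2 => by have := hΔ.2.2 Δ' a1 a2; omega)
          rw [Dl_succ, Pt_succ, ham, if_neg (by omega), if_neg (by omega), hch.1, hch.2]
          exact ⟨by abel, rfl⟩
        · have hno : ¬ ∃ Δ, IsNext m c Δ := by
            rintro ⟨Δ, a1, a2, a3⟩
            exact hex ⟨Δ, a1.1, a2.le⟩
          refine ⟨fun Δ hΔ => absurd ⟨Δ, hΔ⟩ hno, fun _ => ?_⟩
          have hE : Ec b m n c (am (Ec b m n c) b X) ≤ 0 := by
            have e1 := hall _ j1 j2
            have e2 := hcomp.2.1 _ j1 (Kn_zero (by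
              rintro ⟨r, r1, r2, r3⟩
              exact hex ⟨r, r1, by omega⟩))
            omega
          rw [Dl_succ, Pt_succ, if_pos hE, if_pos hE]
          exact ⟨rfl, rfl⟩

lemma msetMax_none {s : Multiset ℤ} (h : msetMax s = none) : s = 0 := by
  unfold msetMax at h
  by_contra hne
  rw [dif_neg hne] at h
  cases h

lemma msetMin_none {s : Multiset ℤ} (h : msetMin s = none) : s = 0 := by
  unfold msetMin at h
  by_contra hne
  rw [dif_neg hne] at h
  cases h

lemma msetMax_some {s : Multiset ℤ} {y : ℤ} (h : msetMax s = some y) :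
    y ∈ s ∧ ∀ z ∈ s, z ≤ y := by
  unfold msetMax at h
  split_ifs at h with h0
  injection h with h
  subst h
  refine ⟨?_, ?_⟩
  · exact Multiset.mem_toFinset.mp (Finset.max'_mem _ _)
  · intro z hz
    exact Finset.le_max' _ _ (Multiset.mem_toFinset.mpr hz)

lemma msetMin_some {s : Multiset ℤ} {y : ℤ} (h : msetMin s = some y) :
    y ∈ s ∧ ∀ z ∈ s, y ≤ z := by
  unfold msetMin at h
  split_ifs at h with h0
  injection h with h
  subst h
  refine ⟨?_, ?_⟩
  · exact Multiset.mem_toFinset.mp (Finset.min'_mem _ _)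
  · intro z hz
    exact Finset.min'_le _ _ (Multiset.mem_toFinset.mpr hz)

lemma mem_startAt_snd {m : Multiset Seg} {i y : ℤ} :
    y ∈ (startAt m i).map Prod.snd ↔ (i, y) ∈ m := by
  unfold startAt
  rw [Multiset.mem_map]
  constructor
  · rintro ⟨⟨p, q⟩, h1, rfl⟩
    rw [Multiset.mem_filter] at h1
    obtain ⟨h1, h2⟩ := h1
    simp only at h2
    subst h2
    exact h1
  · intro h
    exact ⟨(i, y), Multiset.mem_filter.mpr ⟨h, rfl⟩, rfl⟩

lemma shortStart_none {m : Multiset Seg} {i : ℤ} (h : shortStart m i = none) :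
    ∀ y, (i, y) ∉ m := by
  unfold shortStart at h
  rw [Option.map_eq_none_iff] at h
  have := msetMin_none h
  intro y hy
  rw [← mem_startAt_snd, this] at hy
  simp at hy

lemma longStart_none {m : Multiset Seg} {i : ℤ} (h : longStart m i = none) :
    ∀ y, (i, y) ∉ m := by
  unfold longStart at h
  rw [Option.map_eq_none_iff] at h
  have := msetMax_none h
  intro y hy
  rw [← mem_startAt_snd, this] at hy
  simp at hy

lemma shortStart_some {m : Multiset Seg} {i : ℤ} {Δ : Seg} (h : shortStart m i = some Δ) :
    Δ.1 = i ∧ Δ ∈ m ∧ ∀ y, (i, y) ∈ m → Δ.2 ≤ y := by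
  unfold shortStart at h
  rw [Option.map_eq_some_iff] at h
  obtain ⟨y, h1, rfl⟩ := h
  obtain ⟨h2, h3⟩ := msetMin_some h1
  exact ⟨rfl, mem_startAt_snd.mp h2, fun z hz => h3 z (mem_startAt_snd.mpr hz)⟩

lemma longStart_some {m : Multiset Seg} {i : ℤ} {Δ : Seg} (h : longStart m i = some Δ) :
    Δ.1 = i ∧ Δ ∈ m ∧ ∀ y, (i, y) ∈ m → y ≤ Δ.2 := by
  unfold longStart at h
  rw [Option.map_eq_some_iff] at h
  obtain ⟨y, h1, rfl⟩ := h
  obtain ⟨h2, h3⟩ := msetMax_some h1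
  exact ⟨rfl, mem_startAt_snd.mp h2, fun z hz => h3 z (mem_startAt_snd.mpr hz)⟩

lemma dsNext_none {b : ℤ} {m : Multiset Seg} (hR : Rng b m) {p : Seg} (hp : IsRec m p)
    (h : dsNext m p = none) : ∀ Δ, IsRec m Δ → ¬ Δ.1 < p.1 := by
  intro Δ hΔ hlt
  have hmem : Δ ∈ m.filter fun Δ => Prec Δ p := by
    rw [Multiset.mem_filter]
    refine ⟨hΔ.1, hlt, (hΔ.2 p hp.1).1 hlt, ?_⟩
    have h1 := hR _ hΔ.1
    have h2 := hR _ hp.1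
    omega
  unfold dsNext at h
  split at h
  · rename_i h0
    have := msetMax_none h0
    rw [Multiset.map_eq_zero] at this
    rw [this] at hmem
    simp at hmem
  · rename_i aq h0
    have h3 := (msetMax_some h0).1
    rw [Multiset.mem_map] at h3
    obtain ⟨⟨x, y⟩, h4, h5⟩ := h3
    simp only at h5
    subst h5
    exact shortStart_none h y (Multiset.mem_filter.mp h4).1

lemma dsNext_some {b : ℤ} {m : Multiset Seg} (hR : Rng b m) {p Δ : Seg} (hp : IsRec m p)
    (h : dsNext m p = some Δ) :
    IsRec m Δ ∧ Δ.1 < p.1 ∧ ∀ Δ', IsRec m Δ' → Δ'.1 < p.1 → Δ'.1 ≤ Δ.1 := by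
  unfold dsNext at h
  split at h
  · cases h
  · rename_i aq h0
    obtain ⟨h1, h2⟩ := msetMax_some h0
    rw [Multiset.mem_map] at h1
    obtain ⟨⟨x, y⟩, h4, h5⟩ := h1
    simp only at h5
    subst h5
    rw [Multiset.mem_filter] at h4
    obtain ⟨h4, h5, h6, h7⟩ := h4
    simp only at h5 h6 h7
    obtain ⟨k1, k2, k3⟩ := shortStart_some h
    have k4 := k3 y h4
    refine ⟨⟨k2, ?_⟩, by omega, ?_⟩
    · intro Δ' hΔ'
      refine ⟨?_, ?_⟩
      · intro hlt
        obtain ⟨q1, q2⟩ := hp.2 Δ' hΔ'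
        rcases lt_trichotomy Δ'.1 p.1 with hc | hc | hc
        · by_contra hcon
          have hmem : Δ' ∈ m.filter fun Δ => Prec Δ p := by
            rw [Multiset.mem_filter]
            refine ⟨hΔ', hc, by omega, ?_⟩
            have h1 := hR _ hΔ'
            have h2 := hR _ hp.1
            omega
          have := h2 _ (Multiset.mem_map_of_mem Prod.fst hmem)
          omega
        · have := q2 hc; omega
        · have := q1 hc; omega
      · intro he
        apply k3
        rw [← k1, ← he]
        exact hΔ'
    · intro Δ' hΔ' hlt
      have hmem : Δ' ∈ m.filter fun Δ => Prec Δ p := by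
        rw [Multiset.mem_filter]
        refine ⟨hΔ'.1, hlt, (hΔ'.2 p hp.1).1 hlt, ?_⟩
        have h1 := hR _ hΔ'.1
        have h2 := hR _ hp.1
        omega
      have := h2 _ (Multiset.mem_map_of_mem Prod.fst hmem)
      omega

lemma dsAux_spec {b : ℤ} {m : Multiset Seg} (hR : Rng b m) (k : ℕ) :
    ∀ p, IsRec m p → (m.filter fun Δ => Δ.1 < p.1).card ≤ k →
      (∀ Δ, Δ ∈ dsAux m k p ↔ IsRec m Δ ∧ Δ.1 < p.1) ∧
      (dsAux m k p).Pairwise fun p q => q.1 < p.1 := by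
  induction k with
  | zero =>
    intro p hp hk
    have h0 : m.filter (fun Δ => Δ.1 < p.1) = 0 := Multiset.card_eq_zero.mp (by omega)
    refine ⟨?_, by simp [dsAux]⟩
    intro Δ
    simp only [dsAux, List.not_mem_nil, false_iff]
    rintro ⟨h1, h2⟩
    have : Δ ∈ m.filter (fun Δ => Δ.1 < p.1) := Multiset.mem_filter.mpr ⟨h1.1, h2⟩
    rw [h0] at this
    simp at this
  | succ k ih =>
    intro p hp hk
    unfold dsAux
    split
    · rename_i h0
      have := dsNext_none hR hp h0
      refine ⟨?_, by simp⟩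
      intro Δ
      simp only [List.not_mem_nil, false_iff]
      rintro ⟨h1, h2⟩
      exact this Δ h1 h2
    · rename_i Δ h0
      obtain ⟨h1, h2, h3⟩ := dsNext_some hR hp h0
      have hlt : (m.filter fun Δ' => Δ'.1 < Δ.1).card < (m.filter fun Δ => Δ.1 < p.1).card := by
        apply Multiset.card_lt_card
        refine lt_of_le_of_ne (Multiset.monotone_filter_right m ?_) ?_
        · intro x hx
          exact lt_trans hx h2
        · intro he
          have : Δ ∈ m.filter fun Δ => Δ.1 < p.1 := Multiset.mem_filter.mpr ⟨h1.1, h2⟩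
          rw [← he, Multiset.mem_filter] at this
          omega
      obtain ⟨q1, q2⟩ := ih Δ h1 (by omega)
      refine ⟨?_, ?_⟩
      · intro Δ'
        rw [List.mem_cons, q1]
        constructor
        · rintro (rfl | ⟨r1, r2⟩)
          · exact ⟨h1, h2⟩
          · exact ⟨r1, by omega⟩
        · rintro ⟨r1, r2⟩
          rcases eq_or_lt_of_le (h3 Δ' r1 r2) with he | hl
          · left
            have : Δ' = (Δ.1, Δ'.2) := by rw [← he]
            rw [this] at r1 ⊢
            have h1' : IsRec m (Δ.1, Δ.2) := h1
            rw [IsRec.unique r1 h1']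
          · exact Or.inr ⟨r1, hl⟩
      · rw [List.pairwise_cons]
        exact ⟨fun x hx => ((q1 x).mp hx).2, q2⟩

lemma dsList_rowDec {b : ℤ} {m : Multiset Seg} (hR : Rng b m) :
    RowDec m (m - (dsList m : Multiset Seg)) (dsList m) := by
  have key : (∀ Δ, Δ ∈ dsList m ↔ IsRec m Δ) ∧ (dsList m).Pairwise fun p q => q.1 < p.1 := by
    unfold dsList
    split
    · rename_i h0
      have h1 := msetMax_none h0
      rw [Multiset.map_eq_zero] at h1
      refine ⟨?_, by simp⟩
      intro Δ
      simp only [List.not_mem_nil, false_iff]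
      intro h
      have := h.1
      rw [h1] at this
      simp at this
    · rename_i a1 h0
      obtain ⟨h1, h2⟩ := msetMax_some h0
      split
      · rename_i h3
        rw [Multiset.mem_map] at h1
        obtain ⟨⟨x, y⟩, h4, rfl⟩ := h1
        exact absurd h4 (shortStart_none h3 y)
      · rename_i Δ1 h3
        obtain ⟨k1, k2, k3⟩ := shortStart_some h3
        have hmax : ∀ Δ ∈ m, Δ.1 ≤ Δ1.1 := by
          intro Δ hΔ
          have := h2 _ (Multiset.mem_map_of_mem Prod.fst hΔ)
          omega
        have hrec : IsRec m Δ1 := by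
          refine ⟨k2, ?_⟩
          intro Δ' hΔ'
          refine ⟨?_, ?_⟩
          · intro h; have := hmax Δ' hΔ'; omega
          · intro h
            apply k3
            rw [← k1, ← h]
            exact hΔ'
        obtain ⟨q1, q2⟩ := dsAux_spec hR m.card Δ1 hrec
          (Multiset.card_le_card (Multiset.filter_le _ _))
        refine ⟨?_, ?_⟩
        · intro Δ
          rw [List.mem_cons, q1]
          constructor
          · rintro (rfl | ⟨r1, r2⟩)
            · exact hrec
            · exact r1
          · intro r1
            rcases eq_or_lt_of_le (hmax Δ r1.1) with he | hl
            · left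
              have : Δ = (Δ1.1, Δ.2) := by rw [← he]
              rw [this] at r1 ⊢
              have h1' : IsRec m (Δ1.1, Δ1.2) := hrec
              rw [IsRec.unique r1 h1']
            · exact Or.inr ⟨r1, hl⟩
        · rw [List.pairwise_cons]
          exact ⟨fun x hx => ((q1 x).mp hx).2, q2⟩
  obtain ⟨k1, k2⟩ := key
  refine ⟨?_, k1, k2⟩
  have hnd : (dsList m : Multiset Seg).Nodup := by
    rw [Multiset.coe_nodup]
    refine k2.imp ?_
    intro x y h he
    subst he
    omega
  have hle : (dsList m : Multiset Seg) ≤ m := by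
    rw [Multiset.le_iff_subset hnd]
    intro x hx
    exact ((k1 x).mp hx).1
  rw [add_comm]
  exact (tsub_add_cancel_of_le hle).symm

lemma findRowI_spec (a : ℤ) (pt : ℤ) (hpt : a ≤ pt) : ∀ (row : List Seg),
    row.Pairwise (fun p q => q.1 < p.1) →
    (∀ Δ, findRowI a row pt = some Δ →
      Δ ∈ row ∧ pt < Δ.1 ∧ ∀ Δ' ∈ row, Δ'.1 < Δ.1 → Δ'.1 < pt) ∧
    (findRowI a row pt = none →
      ¬ ∃ Δ ∈ row, pt < Δ.1 ∧ ∀ Δ' ∈ row, Δ'.1 < Δ.1 → Δ'.1 < pt)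
  | [], _ => by simp [findRowI]
  | [D], _ => by
    simp only [findRowI, Bool.and_eq_true, decide_eq_true_eq]
    split_ifs with h
    · refine ⟨?_, by simp⟩
      intro Δ hΔ
      injection hΔ with hΔ
      subst hΔ
      refine ⟨by simp, by omega, ?_⟩
      intro Δ' h1 h2
      rw [List.mem_singleton] at h1
      subst h1
      omega
    · refine ⟨by simp, ?_⟩
      rintro - ⟨Δ, h1, h2, h3⟩
      rw [List.mem_singleton] at h1
      subst h1
      omega
  | D :: D' :: rest, hs => by
    have ih := findRowI_spec a pt hpt (D' :: rest) (List.pairwise_cons.mp hs).2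
    have hs1 := (List.pairwise_cons.mp hs).1
    have hs2 := (List.pairwise_cons.mp (List.pairwise_cons.mp hs).2).1
    simp only [findRowI, Bool.and_eq_true, decide_eq_true_eq]
    split_ifs with h
    · refine ⟨?_, by simp⟩
      intro Δ hΔ
      injection hΔ with hΔ
      subst hΔ
      refine ⟨by simp, by omega, ?_⟩
      intro Δ' h1 h2
      rw [List.mem_cons, List.mem_cons] at h1
      rcases h1 with rfl | rfl | h1
      · omega
      · omega
      · have := hs2 _ h1; omega
    · refine ⟨?_, ?_⟩
      · intro Δ hΔ
        obtain ⟨k1, k2, k3⟩ := ih.1 Δ hΔ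
        refine ⟨List.mem_cons_of_mem _ k1, k2, ?_⟩
        intro Δ' h1 h2
        rw [List.mem_cons] at h1
        rcases h1 with rfl | h1
        · have := hs1 _ k1; omega
        · exact k3 _ h1 h2
      · rintro hn ⟨Δ, h1, h2, h3⟩
        apply ih.2 hn
        rw [List.mem_cons] at h1
        rcases h1 with rfl | h1
        · exfalso
          have := h3 D' (by simp) (hs1 D' (by simp))
          omega
        · exact ⟨Δ, h1, h2, fun Δ' h => h3 Δ' (List.mem_cons_of_mem _ h)⟩

lemma RowDec.find_some {m rest : Multiset Seg} {row : List Seg} (h : RowDec m rest row)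
    {a pt : ℤ} (hpt : a ≤ pt) {Δ : Seg} (hf : findRowI a row pt = some Δ) : IsNext m pt Δ := by
  obtain ⟨h1, h2, h3⟩ := (findRowI_spec a pt hpt row h.sorted).1 Δ hf
  exact ⟨(h.mem Δ).mp h1, h2, fun Δ' h4 => h3 Δ' ((h.mem Δ').mpr h4)⟩

lemma RowDec.find_none {m rest : Multiset Seg} {row : List Seg} (h : RowDec m rest row)
    {a pt : ℤ} (hpt : a ≤ pt) (hf : findRowI a row pt = none) : ¬ ∃ Δ, IsNext m pt Δ := by
  rintro ⟨Δ, h1, h2, h3⟩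
  exact (findRowI_spec a pt hpt row h.sorted).2 hf
    ⟨Δ, (h.mem Δ).mpr h1, h2, fun Δ' h4 => h3 Δ' ((h.mem Δ').mp h4)⟩

/-- final point of a selection -/
def fin (pt : ℤ) : List (Seg × ℤ) → ℤ
  | [] => pt
  | p :: l => fin p.1.1 l

lemma fin_append (pt : ℤ) (l : List (Seg × ℤ)) (p : Seg × ℤ) : fin pt (l ++ [p]) = p.1.1 := by
  induction l generalizing pt with
  | nil => rfl
  | cons q l ih => exact ih _

lemma fin_getLast (pt : ℤ) (l : List (Seg × ℤ)) :
    fin pt l = match l.getLast? with | none => pt | some (Δ, _) => Δ.1 := by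
  rcases List.eq_nil_or_concat l with rfl | ⟨l', p, rfl⟩
  · rfl
  · rw [List.concat_eq_append, fin_append, List.getLast?_append]
    rfl

/-- what the first row contributes to the selection -/
def lastStep (a : ℤ) (row : List Seg) (pt : ℤ) : List (Seg × ℤ) :=
  match findRowI a row pt with
  | some Δ => [(Δ, pt)]
  | none => []

lemma selAuxI_cons (a : ℤ) (row : List Seg) (rows : List (List Seg)) (n : ℕ) : ∀ pt,
    selAuxI a (row :: rows) (n + 1) pt =
      selAuxI a rows n pt ++ lastStep a row (fin pt (selAuxI a rows n pt)) := by
  induction n with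
  | zero =>
    intro pt
    simp only [selAuxI, lastStep, fin, List.getD_cons_zero, List.nil_append]
  | succ n ih =>
    intro pt
    have e1 : selAuxI a rows (n + 1) pt = match findRowI a (rows.getD n []) pt with
      | some Δ => (Δ, pt) :: selAuxI a rows n Δ.1
      | none => selAuxI a rows n pt := rfl
    have e2 : selAuxI a (row :: rows) (n + 1 + 1) pt = match findRowI a (rows.getD n []) pt with
      | some Δ => (Δ, pt) :: selAuxI a (row :: rows) (n + 1) Δ.1
      | none => selAuxI a (row :: rows) (n + 1) pt := rfl
    rw [e1, e2]
    cases findRowI a (rows.getD n []) pt with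
    | none => exact ih pt
    | some Δ => simp only [ih, List.cons_append, fin]

/-- weight of a selection -/
def wt (sel : List (Seg × ℤ)) : Seg → ℤ :=
  (sel.map fun p => dl (p.2, p.1.2) - dl p.1).sum

lemma zero_Hc (b : ℤ) (n : ℕ) (c t : ℤ) : Hc b 0 n c t = 0 := by
  induction n generalizing c t with
  | zero => rfl
  | succ n ih =>
    rw [Hc_succ]
    simp [Ec, ih, cnt]

lemma zero_Ec (b : ℤ) (n : ℕ) (c t : ℤ) : Ec b 0 n c t = 0 := by
  simp [Ec, zero_Hc, cnt]

lemma zero_Dl (b : ℤ) (n : ℕ) (c X : ℤ) : Dl b 0 n c X = dl (c, b) := by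
  cases n with
  | zero => rfl
  | succ n => rw [Dl_succ, if_pos (zero_Ec ..).le]

lemma zero_Pt (b : ℤ) (n : ℕ) (c X : ℤ) : Pt b 0 n c X = c := by
  cases n with
  | zero => rfl
  | succ n => rw [Pt_succ, if_pos (zero_Ec ..).le]

lemma sel_spec {a b B : ℤ} {n : ℕ} (hn : a + n = b + 2) (hB : b ≤ B) (k : ℕ) :
    ∀ r : Multiset Seg, r.card ≤ k → Rng b r → (∀ Δ ∈ r, a ≤ Δ.1) → (∀ Δ ∈ r, Δ.2 ≤ B) →
    ∀ sel, sel = selAuxI a (dsDecomp k r) (dsDecomp k r).length a →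
      wt sel + dl (fin a sel, b) = Dl b r n a B ∧ fin a sel = Pt b r n a B ∧
      ((sel.map Prod.fst : List Seg) : Multiset Seg) ≤ r ∧ (∀ p ∈ sel, p.2 < p.1.1) ∧
      a ≤ fin a sel := by
  induction k with
  | zero =>
    intro r hk _ _ _ sel hsel
    have h0 : r = 0 := Multiset.card_eq_zero.mp (by omega)
    subst h0
    simp only [dsDecomp, List.length_nil, selAuxI] at hsel
    subst hsel
    refine ⟨?_, ?_, ?_, ?_, ?_⟩
    · simp [wt, fin, zero_Dl]
    · simp [fin, zero_Pt]
    · simp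
    · simp
    · simp [fin]
  | succ k ih =>
    intro r hk hR ha hBr sel hsel
    by_cases h0 : r = 0
    · subst h0
      simp only [dsDecomp, if_true, List.length_nil, selAuxI] at hsel
      subst hsel
      refine ⟨?_, ?_, ?_, ?_, ?_⟩
      · simp [wt, fin, zero_Dl]
      · simp [fin, zero_Pt]
      · simp
      · simp
      · simp [fin]
    · have hrow := dsList_rowDec hR
      set row := dsList r with hrowdef
      set rest := r - (row : Multiset Seg) with hrest
      have hle : rest ≤ r := Multiset.sub_le_self _ _
      have hcard : rest.card < r.card := by
        apply Multiset.card_lt_card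
        refine lt_of_le_of_ne hle ?_
        intro he
        obtain ⟨Δ, hΔ⟩ := Multiset.exists_mem_of_ne_zero h0
        obtain ⟨D, hD⟩ := rec_below (m := r) (c := Δ.1) (t := Δ.2) ⟨Δ, hΔ, le_rfl, le_rfl⟩
        have h1 : D ∈ row := (hrow.mem D).mpr hD.1
        have h2 := congrArg Multiset.card hrow.eq
        rw [Multiset.card_add, he, Multiset.coe_card] at h2
        have : row = [] := List.length_eq_zero_iff.mp (by omega)
        rw [this] at h1
        simp at h1
      simp only [dsDecomp, if_neg h0, List.length_cons] at hsel
      rw [← hrowdef, ← hrest, selAuxI_cons] at hsel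
      obtain ⟨i1, i2, i3, i4, i5⟩ := ih rest (by omega)
        (fun Δ h => hR Δ (Multiset.mem_of_le hle h)) (fun Δ h => ha Δ (Multiset.mem_of_le hle h))
        (fun Δ h => hBr Δ (Multiset.mem_of_le hle h)) _ rfl
      set sel0 := selAuxI a (dsDecomp k rest) (dsDecomp k rest).length a with hsel0
      obtain ⟨s1, s2⟩ := hrow.step hR n a B hn hB (by
        rintro ⟨Δ, h1, h2⟩
        exact ⟨Δ, h1, h2, hBr Δ h1⟩)
      rw [← i1, ← i2] at s1
      rw [← i1, ← i2] at s2
      unfold lastStep at hsel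
      split at hsel
      · rename_i Δ hf
        have hnx := hrow.find_some i5 hf
        obtain ⟨t1, t2⟩ := s1 Δ hnx
        subst hsel
        rw [fin_append]
        refine ⟨?_, t2.symm, ?_, ?_, ?_⟩
        · rw [t1]
          simp only [wt, List.map_append, List.sum_append, List.map_cons, List.map_nil,
            List.sum_cons, List.sum_nil]
          abel
        · rw [List.map_append, ← Multiset.coe_add, hrow.eq, add_comm]
          refine add_le_add ?_ i3
          simp only [List.map_cons, List.map_nil]
          rw [Multiset.coe_singleton, Multiset.singleton_le]
          exact (hrow.mem Δ).mpr hnx.1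
        · intro p hp
          rw [List.mem_append, List.mem_singleton] at hp
          rcases hp with hp | rfl
          · exact i4 p hp
          · exact hnx.2.1
        · have := hnx.2.1
          simp only
          omega
      · rename_i hf
        obtain ⟨t1, t2⟩ := s2 (hrow.find_none i5 hf)
        rw [List.append_nil] at hsel
        subst hsel
        exact ⟨t1.symm, t2.symm, i3.trans hle, i4, i5⟩

lemma foldl_count (Δ : Seg) (sel : List (Seg × ℤ)) : ∀ acc : Multiset Seg,
    ((sel.map Prod.fst : List Seg) : Multiset Seg) ≤ acc → (∀ p ∈ sel, p.2 ≤ p.1.2) →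
    (((sel.foldl (fun acc p => pushSeg (acc.erase p.1) p.2 p.1.2) acc).count Δ : ℕ) : ℤ) =
      acc.count Δ + wt sel Δ := by
  induction sel with
  | nil => intro acc _ _; simp [wt]
  | cons p l ih =>
    intro acc h1 h2
    rw [List.map_cons, ← Multiset.cons_coe] at h1
    have hmem : p.1 ∈ acc := Multiset.mem_of_le h1 (Multiset.mem_cons_self _ _)
    have hp := h2 p (by simp)
    rw [List.foldl_cons, ih]
    · unfold pushSeg
      rw [if_pos hp, Multiset.count_add, Multiset.count_singleton]
      have he : (acc.count Δ : ℤ) = (acc.erase p.1).count Δ + dl p.1 Δ := by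
        conv_lhs => rw [← Multiset.cons_erase hmem]
        rw [Multiset.count_cons]
        unfold dl
        by_cases h : Δ = p.1
        · simp [h]
        · rw [if_neg h, if_neg (fun h' => h h'.symm)]; simp
      rw [he]
      simp only [wt, List.map_cons, List.sum_cons, Pi.add_apply, Pi.sub_apply]
      have : (((if Δ = (p.2, p.1.2) then 1 else 0 : ℕ)) : ℤ) = dl (p.2, p.1.2) Δ := by
        unfold dl
        by_cases h : Δ = (p.2, p.1.2)
        · simp [h]
        · rw [if_neg h, if_neg (fun h' => h h'.symm)]; simp
      push_cast [← this]
      ring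
    · unfold pushSeg
      rw [if_pos hp]
      refine le_trans ?_ (Multiset.le_add_right _ _)
      have := Multiset.erase_le_erase p.1 h1
      rwa [Multiset.erase_cons_head] at this
    · intro q hq
      exact h2 q (List.mem_cons_of_mem _ hq)

lemma pushSeg_isMS {m : Multiset Seg} (hm : IsMS m) (x y : ℤ) : IsMS (pushSeg m x y) := by
  unfold pushSeg
  split_ifs with h
  · intro Δ hΔ
    rw [Multiset.mem_add, Multiset.mem_singleton] at hΔ
    rcases hΔ with hΔ | rfl
    · exact hm Δ hΔ
    · exact h
  · exact hm

lemma erase_isMS {m : Multiset Seg} (hm : IsMS m) (p : Seg) : IsMS (m.erase p) :=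
  fun Δ hΔ => hm Δ (Multiset.mem_of_mem_erase hΔ)

lemma foldl_isMS (sel : List (Seg × ℤ)) : ∀ acc : Multiset Seg, IsMS acc →
    IsMS (sel.foldl (fun acc p => pushSeg (acc.erase p.1) p.2 p.1.2) acc) := by
  induction sel with
  | nil => intro acc h; exact h
  | cons p l ih =>
    intro acc h
    exact ih _ (pushSeg_isMS (erase_isMS h _) _ _)

lemma ILang_eq (a b : ℤ) (m : Multiset Seg) (sel : List (Seg × ℤ))
    (h : sel = selAuxI a (dsDecomp (mRange m a b).card (mRange m a b))
      (dsDecomp (mRange m a b).card (mRange m a b)).length a) :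
    ILang a b m = pushSeg (sel.foldl (fun acc p => pushSeg (acc.erase p.1) p.2 p.1.2) m)
      (fin a sel) b := by
  rw [fin_getLast]
  unfold ILang
  simp only
  rw [← h]
  cases sel.getLast? <;> rfl

lemma ILang_isMS {m : Multiset Seg} (hm : IsMS m) (a b : ℤ) : IsMS (ILang a b m) := by
  rw [ILang_eq a b m _ rfl]
  exact pushSeg_isMS (foldl_isMS _ _ hm) _ _

lemma ILang_count {m : Multiset Seg} {a b B : ℤ} {n : ℕ} (hn : a + n = b + 2) (hB : b ≤ B)
    (hmB : ∀ Δ ∈ mRange m a b, Δ.2 ≤ B) (Δ : Seg) (hΔ : Δ.1 ≤ Δ.2) :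
    (((ILang a b m).count Δ : ℕ) : ℤ) = m.count Δ + Dl b (mRange m a b) n a B Δ := by
  have hmr : ∀ D ∈ mRange m a b, a ≤ D.1 ∧ D.1 ≤ b + 1 ∧ b ≤ D.2 :=
    fun D hD => (Multiset.mem_filter.mp hD).2
  obtain ⟨h1, h2, h3, h4, h5⟩ := sel_spec hn hB (mRange m a b).card (mRange m a b) le_rfl
    (fun D hD => (hmr D hD).2) (fun D hD => (hmr D hD).1) hmB _ rfl
  rw [ILang_eq a b m _ rfl]
  set sel := selAuxI a (dsDecomp (mRange m a b).card (mRange m a b))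
      (dsDecomp (mRange m a b).card (mRange m a b)).length a with hsel
  have hf := foldl_count Δ sel m (h3.trans (Multiset.filter_le _ _)) (by
    intro p hp
    have k1 := h4 p hp
    have k2 : p.1 ∈ mRange m a b :=
      Multiset.mem_of_le h3 (Multiset.mem_coe.mpr (List.mem_map_of_mem hp))
    have := hmr _ k2
    omega)
  rw [← h1, Pi.add_apply, ← add_assoc, ← hf]
  unfold pushSeg
  split_ifs with hc
  · rw [Multiset.count_add, Multiset.count_singleton]
    unfold dl
    by_cases h : Δ = (fin a sel, b)
    · simp [h]
    · rw [if_neg h, if_neg (fun h' => h h'.symm)]; simp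
  · unfold dl
    rw [if_neg (by rintro rfl; exact hc hΔ)]
    simp

/-- the function controlling the `ρ`-integral -/
def gg (m : Multiset Seg) (a s : ℤ) : ℤ := cnt m (a + 1) s - cnt m a (s - 1)

lemma cnt_lt {m : Multiset Seg} {c s u : ℤ} (h : (c, u) ∈ m) (hs : s < u) :
    cnt m c s < cnt m c u := by
  rw [← Multiset.cons_erase h, ← Multiset.singleton_add, cnt_add, cnt_add, cnt_singleton,
    cnt_singleton, if_neg (by simp only [true_and]; omega), if_pos (by simp)]
  have := cnt_mono (m.erase (c, u)) c hs.le
  omega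

lemma cnt_congr {m : Multiset Seg} {c s t : ℤ} (h : s ≤ t)
    (hno : ∀ w, (c, w) ∈ m → w ≤ t → w ≤ s) : cnt m c s = cnt m c t := by
  unfold cnt
  congr 2
  apply Multiset.filter_congr
  rintro ⟨x, y⟩ hxy
  simp only
  constructor
  · rintro ⟨h1, h2⟩; exact ⟨h1, by omega⟩
  · rintro ⟨h1, h2⟩; subst h1; exact ⟨rfl, hno y hxy h2⟩

lemma terminal_long {n : Multiset Seg} {a b B y : ℤ}
    (h1 : ∀ y, (a + 1, y) ∈ n → b ≤ y ∧ y ≤ B)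
    (ht : ∀ u, (a + 1, u) ∈ n → ∀ v, (a, v) ∈ n → u ≤ v)
    (hy : IsAM (gg n a) b B y) :
    (longStart n (a + 1) = none → gg n a y ≤ 0) ∧
    (∀ Δ, longStart n (a + 1) = some Δ → Δ = (a + 1, y) ∧ 0 < gg n a y) := by
  constructor
  · intro h
    have h2 := longStart_none h
    have h3 : cnt n (a + 1) y = 0 := cnt_zero (fun w hw => absurd hw (h2 w))
    have := cnt_nonneg n a (y - 1)
    unfold gg
    omega
  · rintro ⟨x, u⟩ h
    obtain ⟨k1, k2, k3⟩ := longStart_some h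
    simp only at k1 k3
    subst k1
    have hu := h1 u k2
    have h0 : ∀ s, s ≤ u → cnt n a (s - 1) = 0 := by
      intro s hs
      apply cnt_zero
      intro v hv
      have := ht u k2 v hv
      omega
    have hmaxc : ∀ s, cnt n (a + 1) s ≤ cnt n (a + 1) u := by
      intro s
      rcases le_total s u with hs | hs
      · exact cnt_mono _ _ hs
      · rw [cnt_congr hs (fun w hw _ => k3 w hw)]
    have hAM : IsAM (gg n a) b B u := by
      refine ⟨hu.1, hu.2, ?_, ?_⟩
      · intro s _ _
        unfold gg
        rw [h0 u le_rfl]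
        have := hmaxc s
        have := cnt_nonneg n a (s - 1)
        omega
      · intro s _ hs
        unfold gg
        rw [h0 u le_rfl]
        have := cnt_lt k2 hs
        have := cnt_nonneg n a (s - 1)
        omega
    have hyu := hy.unique hAM
    subst hyu
    refine ⟨rfl, ?_⟩
    unfold gg
    rw [h0 y le_rfl]
    have := cnt_lt (s := y - 1) k2 (by omega)
    have := cnt_nonneg n (a + 1) (y - 1)
    omega

lemma tusStep_none {n : Multiset Seg} {a b : ℤ} (hab : a ≤ b)
    (h0 : ∀ y, (a, y) ∈ n → b ≤ y) (h : tusStep n a = none) :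
    ∀ u, (a + 1, u) ∈ n → ∀ v, (a, v) ∈ n → u ≤ v := by
  intro u hu v hv
  unfold tusStep at h
  split at h
  · rename_i h1
    exact absurd hv (shortStart_none h1 v)
  · rename_i Δ h1
    obtain ⟨k1, k2, k3⟩ := shortStart_some h1
    split at h
    · rename_i h2
      have h3 := msetMin_none h2
      rw [Multiset.map_eq_zero] at h3
      by_contra hcon
      have hmem : (a + 1, u) ∈ (startAt n (a + 1)).filter fun Δ' => Prec Δ Δ' := by
        rw [Multiset.mem_filter]
        refine ⟨Multiset.mem_filter.mpr ⟨hu, rfl⟩, ?_⟩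
        have q1 := k3 v hv
        obtain ⟨x, w⟩ := Δ
        simp only at k1 q1
        subst k1
        have q2 := h0 w k2
        refine ⟨?_, ?_, ?_⟩ <;> simp only <;> omega
      rw [h3] at hmem
      simp at hmem
    · cases h

lemma tusStep_some {n n1 : Multiset Seg} {a : ℤ} (h : tusStep n a = some n1) :
    ∃ v u, n = {(a, v)} + ({(a + 1, u)} + n1) ∧ v < u ∧ (∀ w, (a, w) ∈ n → v ≤ w) ∧
      (a ≤ v → ∀ w, (a + 1, w) ∈ n → v < w → u ≤ w) := by
  unfold tusStep at h
  split at h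
  · cases h
  · rename_i Δ h1
    obtain ⟨k1, k2, k3⟩ := shortStart_some h1
    split at h
    · cases h
    · rename_i u h2
      injection h with h
      obtain ⟨h3, h4⟩ := msetMin_some h2
      rw [Multiset.mem_map] at h3
      obtain ⟨⟨x, u'⟩, h5, h6⟩ := h3
      simp only at h6
      subst h6
      rw [Multiset.mem_filter, startAt, Multiset.mem_filter] at h5
      obtain ⟨⟨h5, h7⟩, h8⟩ := h5
      simp only at h7
      subst h7
      obtain ⟨x, v⟩ := Δ
      simp only at k1 k3
      subst k1
      refine ⟨v, u', ?_, h8.2.1, k3, ?_⟩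
      · rw [← h, Multiset.singleton_add, Multiset.singleton_add, Multiset.cons_erase,
          Multiset.cons_erase k2]
        rw [Multiset.mem_erase_of_ne]
        · exact h5
        · intro he
          have := congrArg Prod.fst he
          simp only at this
          omega
      · intro hav w hw hvw
        apply h4
        rw [Multiset.mem_map]
        refine ⟨(x + 1, w), ?_, rfl⟩
        rw [Multiset.mem_filter, startAt, Multiset.mem_filter]
        refine ⟨⟨hw, rfl⟩, ?_, ?_, ?_⟩ <;> (try simp only) <;> omega

lemma tusIterF_spec {a b B : ℤ} (hab : a ≤ b) (k : ℕ) : ∀ n : Multiset Seg, n.card ≤ k →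
    (∀ y, (a, y) ∈ n → b ≤ y ∧ y ≤ B) → (∀ y, (a + 1, y) ∈ n → b ≤ y ∧ y ≤ B) →
    ∀ y, IsAM (gg n a) b B y → tusIterF a k n ≤ n ∧
    (longStart (tusIterF a k n) (a + 1) = none → gg n a y ≤ 0) ∧
    (∀ Δ, longStart (tusIterF a k n) (a + 1) = some Δ → Δ = (a + 1, y) ∧ 0 < gg n a y) := by
  induction k with
  | zero =>
    intro n hk h0 h1 y hy
    have hn : n = 0 := Multiset.card_eq_zero.mp (by omega)
    exact ⟨le_rfl, terminal_long (n := n) h1 (by intro u hu; rw [hn] at hu; simp at hu) hy⟩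
  | succ k ih =>
    intro n hk h0 h1 y hy
    rw [tusIterF]
    split
    · rename_i hs
      exact ⟨le_rfl, terminal_long h1 (tusStep_none hab (fun y hy => (h0 y hy).1) hs) hy⟩
    · rename_i n1 hs
      obtain ⟨v, u, e1, e2, e3, e4⟩ := tusStep_some hs
      have hle : n1 ≤ n := by
        rw [e1]
        exact (Multiset.le_add_left _ _).trans (Multiset.le_add_left _ _)
      have hv : (a, v) ∈ n := by rw [e1]; simp
      have hvb := h0 v hv
      have e4' := e4 (by omega)
      have hcard : n1.card + 2 = n.card := by
        rw [e1]; simp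
      have hg : ∀ s, gg n1 a s = gg n a s + (if v < s ∧ s < u then 1 else 0) := by
        intro s
        unfold gg
        conv_rhs => rw [e1]
        simp only [cnt_add, cnt_singleton]
        have : ¬ (a = a + 1) := by omega
        have : ¬ (a + 1 = a) := by omega
        simp only [*, false_and, true_and, if_false]
        split_ifs <;> omega
      have hin : ∀ s, v < s → s < u → gg n a s ≤ gg n a v - 1 := by
        intro s hs1 hs2
        unfold gg
        have q1 : cnt n (a + 1) v = cnt n (a + 1) s := cnt_congr hs1.le (by
          intro w hw hws
          by_contra hc
          have := e4' w hw (by omega)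
          omega)
        have q2 : cnt n a (v - 1) < cnt n a v := cnt_lt hv (by omega)
        have q3 : cnt n a v ≤ cnt n a (s - 1) := cnt_mono _ _ (by omega)
        omega
      obtain ⟨y1, y2, y3, y4⟩ := hy
      have hyv := y3 v hvb.1 hvb.2
      have hyn : ¬ (v < y ∧ y < u) := by
        rintro ⟨p1, p2⟩
        have := hin y p1 p2
        omega
      have hgy : gg n1 a y = gg n a y := by
        rw [hg, if_neg hyn]; omega
      have hy' : IsAM (gg n1 a) b B y := by
        refine ⟨y1, y2, ?_, ?_⟩
        · intro s hs1 hs2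
          rw [hgy, hg]
          have := y3 s hs1 hs2
          split_ifs with hc
          · have := hin s hc.1 hc.2
            omega
          · omega
        · intro s hs1 hs2
          rw [hgy, hg]
          have := y4 s hs1 hs2
          split_ifs with hc
          · have := hin s hc.1 hc.2
            have := y4 v hvb.1 (by omega)
            omega
          · omega
      obtain ⟨i1, i2, i3⟩ := ih n1 (by omega)
        (fun y hy => h0 y (Multiset.mem_of_le hle hy))
        (fun y hy => h1 y (Multiset.mem_of_le hle hy)) y hy'
      rw [hgy] at i2 i3
      exact ⟨i1.trans hle, i2, i3⟩

lemma Irho_spec {a b B y : ℤ} (hab : a ≤ b) {n : Multiset Seg}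
    (h0 : ∀ y, (a, y) ∈ n → b ≤ y ∧ y ≤ B) (h1 : ∀ y, (a + 1, y) ∈ n → b ≤ y ∧ y ≤ B)
    (hy : IsAM (gg n a) b B y) :
    (gg n a y ≤ 0 → Irho a n = n + {(a, a)}) ∧
    (0 < gg n a y → (a + 1, y) ∈ n ∧ Irho a n = n.erase (a + 1, y) + {(a, y)}) := by
  obtain ⟨k1, k2, k3⟩ := tusIterF_spec hab n.card n le_rfl h0 h1 y hy
  change tusIter a n ≤ n at k1
  change longStart (tusIter a n) (a + 1) = none → _ at k2
  change ∀ Δ, longStart (tusIter a n) (a + 1) = some Δ → _ at k3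
  unfold Irho
  split
  · rename_i h
    have := k2 h
    exact ⟨fun _ => rfl, fun h' => by omega⟩
  · rename_i Δ h
    obtain ⟨q1, q2⟩ := k3 Δ h
    refine ⟨fun h' => by omega, fun _ => ?_⟩
    have hm := Multiset.mem_of_le k1 (longStart_some h).2.1
    subst q1
    refine ⟨hm, ?_⟩
    unfold pushSeg
    rw [if_pos]
    have := h1 y hm
    simp only
    omega

lemma core {b B : ℤ} {D g D' g' gt R Rt : ℤ → ℤ} {xa xa1 y : ℤ}
    (hR1 : ∀ s r, b ≤ r → r ≤ s → D r ≤ R s) (hR2 : ∀ s, b ≤ s → ∃ r, b ≤ r ∧ r ≤ s ∧ R s = D r)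
    (hT1 : ∀ s r, b ≤ r → r ≤ s → D' r ≤ Rt s)
    (hT2 : ∀ s, b ≤ s → ∃ r, b ≤ r ∧ r ≤ s ∧ Rt s = D' r)
    (hD' : ∀ r, D' r = D r + if y < r then 1 else 0)
    (hgt : ∀ s, gt s = g s - (if y ≤ s then 1 else 0) - (if y < s then 1 else 0))
    (hg' : ∀ s, g' s = g s + (if xa1 ≤ s then 1 else 0) - (if xa ≤ s then 1 else 0)
      - (if xa < s then 1 else 0))
    (hxa : IsAM (fun s => R s + g s) b B xa) (hxa1 : IsAM D b xa xa1) (hy : IsAM g b B y) :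
    ∃ xt y', IsAM (fun s => Rt s + gt s) b B xt ∧ IsAM D' b xt xa1 ∧ IsAM g' b B y' ∧
      g' y' = g y ∧ ((y = xa ∧ xt = y') ∨ (xt = xa ∧ y' = y)) := by
  obtain ⟨p1, p2, p3, p4⟩ := hxa
  obtain ⟨q1, q2, q3, q4⟩ := hxa1
  obtain ⟨y1, y2, y3, y4⟩ := hy
  simp only at p3 p4
  have hmono : ∀ s t, b ≤ s → s ≤ t → R s ≤ R t := by
    intro s t h1 h2
    obtain ⟨r, r1, r2, r3⟩ := hR2 s h1
    rw [r3]
    exact hR1 t r r1 (by omega)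
  have hRxa : R xa = D xa1 := by
    obtain ⟨r, r1, r2, r3⟩ := hR2 xa p1
    have := hR1 xa xa1 q1 q2
    have := q3 r r1 r2
    omega
  have hTle : ∀ s, b ≤ s → Rt s ≤ R s + 1 := by
    intro s h1
    obtain ⟨r, r1, r2, r3⟩ := hT2 s h1
    have := hR1 s r r1 r2
    have := hD' r
    split_ifs at this <;> omega
  have hTlow : ∀ s, b ≤ s → s ≤ y → Rt s = R s := by
    intro s h1 h2
    obtain ⟨r, r1, r2, r3⟩ := hT2 s h1
    obtain ⟨r', r1', r2', r3'⟩ := hR2 s h1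
    have h3 := hR1 s r r1 r2
    have h4 := hT1 s r' r1' r2'
    have h5 := hD' r
    have h6 := hD' r'
    rw [if_neg (by omega)] at h5 h6
    omega
  have hxy : y ≤ xa := by
    by_contra hc
    have h1 := y4 xa p1 (by omega)
    have h2 := p3 y y1 y2
    have h3 := hmono xa y p1 (by omega)
    omega
  have hRge : ∀ s, xa1 ≤ s → s ≤ xa → R s = R xa := by
    intro s h1 h2
    have := hR1 s xa1 q1 h1
    have := hmono s xa (by omega) h2
    omega
  rcases eq_or_lt_of_le hxy with he | hlt
  · subst he
    have hAM := am_spec (fun s => Rt s + gt s) (b := b) (X := B) (by omega)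
    set xt := am (fun s => Rt s + gt s) b B with hxt
    obtain ⟨x1, x2, x3, x4⟩ := hAM
    simp only at x3 x4
    have hGy : Rt y + gt y = R y + g y - 1 := by
      rw [hTlow y y1 le_rfl, hgt, if_pos le_rfl, if_neg (by omega)]; omega
    have hGs : ∀ s, b ≤ s → s < y → Rt s + gt s = R s + g s := by
      intro s h1 h2
      rw [hTlow s h1 h2.le, hgt, if_neg (by omega), if_neg (by omega)]; omega
    have hGb : ∀ s, b ≤ s → s ≤ B → Rt s + gt s ≤ R y + g y - 1 := by
      intro s h1 h2
      rcases lt_trichotomy s y with h | h | h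
      · rw [hGs s h1 h]
        have := p4 s h1 h
        omega
      · subst h; omega
      · have h3 := hTle s h1
        have h4 := p3 s h1 h2
        rw [hgt, if_pos h.le, if_pos h]
        omega
    have hxty : xt ≤ y := by
      by_contra hc
      have := x4 y y1 (by omega)
      have := hGb xt x1 x2
      omega
    have hval : Rt xt + gt xt = R y + g y - 1 := by
      have := x3 y y1 y2
      have := hGb xt x1 x2
      omega
    have hfact : xt < y → R xt = R y ∧ g xt = g y - 1 ∧ xa1 ≤ xt := by
      intro h
      have h1 := hGs xt x1 h
      have h2 := y4 xt x1 h
      have h3 := hmono xt y x1 h.le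
      refine ⟨by omega, by omega, ?_⟩
      obtain ⟨r, r1, r2, r3⟩ := hR2 xt x1
      by_contra hc
      have := q4 r r1 (by omega)
      omega
    have hxa1t : xa1 ≤ xt := by
      rcases eq_or_lt_of_le hxty with h | h
      · omega
      · exact (hfact h).2.2
    have hg'y : g' xt = g y := by
      rcases eq_or_lt_of_le hxty with h | h
      · rw [hg', h, if_pos q2, if_pos le_rfl, if_neg (by omega)]; omega
      · obtain ⟨f1, f2, f3⟩ := hfact h
        rw [hg', if_pos f3, if_neg (by omega), if_neg (by omega)]; omega
    refine ⟨xt, xt, ⟨x1, x2, x3, x4⟩, ?_, ?_, hg'y, Or.inl ⟨rfl, rfl⟩⟩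
    · refine ⟨q1, hxa1t, ?_, ?_⟩
      · intro s h1 h2
        rw [hD', hD', if_neg (by omega), if_neg (by omega)]
        have := q3 s h1 (by omega)
        omega
      · intro s h1 h2
        rw [hD', hD', if_neg (by omega), if_neg (by omega)]
        have := q4 s h1 h2
        omega
    · refine ⟨x1, x2, ?_, ?_⟩
      · intro s h1 h2
        rw [hg'y, hg']
        have h3 := y3 s h1 h2
        rcases lt_or_ge s y with h | h
        · have := y4 s h1 h
          split_ifs <;> omega
        · split_ifs <;> omega
      · intro s h1 h2
        rw [hg'y, hg', if_neg (by omega : ¬ y ≤ s), if_neg (by omega : ¬ y < s)]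
        have h3 := y4 s h1 (by omega)
        split_ifs with hc
        · have h4 := x4 s h1 h2
          rw [hGs s h1 (by omega), hval, hRge s hc (by omega)] at h4
          omega
        · omega
  · have hRlt : R y < R xa := by
      have := y3 xa p1 p2
      have := p4 y y1 hlt
      omega
    have hya1 : y < xa1 := by
      by_contra hc
      have := hR1 y xa1 q1 (by omega)
      omega
    have hAMD : IsAM D' b xa xa1 := by
      refine ⟨q1, q2, ?_, ?_⟩
      · intro s h1 h2
        rw [hD', hD', if_pos hya1]
        have := q3 s h1 h2
        split_ifs <;> omega
      · intro s h1 h2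
        rw [hD', hD', if_pos hya1]
        have := q4 s h1 h2
        split_ifs <;> omega
    have hTxa : Rt xa = R xa + 1 := by
      have h1 := hT1 xa xa1 q1 q2
      rw [hD', if_pos hya1] at h1
      have h2 := hTle xa p1
      omega
    have hGxa : Rt xa + gt xa = R xa + g xa - 1 := by
      rw [hTxa, hgt, if_pos hlt.le, if_pos hlt]; omega
    have hGge : ∀ s, y < s → Rt s + gt s ≤ R s + g s - 1 := by
      intro s h
      have := hTle s (by omega)
      rw [hgt, if_pos h.le, if_pos h]; omega
    have hGle : ∀ s, b ≤ s → s ≤ y → Rt s + gt s < R xa + g xa - 1 := by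
      intro s h1 h2
      have h5 := p4 y y1 hlt
      rw [hTlow s h1 h2, hgt, if_neg (by omega : ¬ y < s)]
      rcases eq_or_lt_of_le h2 with h | h
      · rw [if_pos h.ge, h]; omega
      · have h3 := y4 s h1 h
        have h4 := hmono s y h1 h2
        rw [if_neg (by omega)]; omega
    have hg'y : g' y = g y := by
      rw [hg', if_neg (by omega), if_neg (by omega), if_neg (by omega)]; omega
    refine ⟨xa, y, ⟨p1, p2, ?_, ?_⟩, hAMD, ⟨y1, y2, ?_, ?_⟩, hg'y, Or.inr ⟨rfl, rfl⟩⟩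
    · intro s h1 h2
      simp only
      rw [hGxa]
      rcases le_or_gt s y with h | h
      · exact (hGle s h1 h).le
      · have := hGge s h
        have := p3 s h1 h2
        omega
    · intro s h1 h2
      simp only
      rw [hGxa]
      rcases le_or_gt s y with h | h
      · exact hGle s h1 h
      · have := hGge s h
        have := p4 s h1 h2
        omega
    · intro s h1 h2
      rw [hg'y, hg']
      have h3 := y3 s h1 h2
      have h4 := y3 xa p1 p2
      by_cases h5 : xa1 ≤ s ∧ s < xa
      · have h6 := p4 s h1 h5.2
        rw [hRge s h5.1 h5.2.le] at h6
        split_ifs <;> omega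
      · split_ifs <;> omega
    · intro s h1 h2
      rw [hg'y, hg', if_neg (by omega), if_neg (by omega), if_neg (by omega)]
      have := y4 s h1 h2
      omega

lemma core0 {b B : ℤ} {D g g' R : ℤ → ℤ} {xa xa1 : ℤ}
    (hR1 : ∀ s r, b ≤ r → r ≤ s → D r ≤ R s) (hR2 : ∀ s, b ≤ s → ∃ r, b ≤ r ∧ r ≤ s ∧ R s = D r)
    (hg' : ∀ s, g' s = g s + (if xa1 ≤ s then 1 else 0) - (if xa ≤ s then 1 else 0)
      - (if xa < s then 1 else 0))
    (hxa : IsAM (fun s => R s + g s) b B xa) (hxa1 : IsAM D b xa xa1)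
    (hy : ∀ s, b ≤ s → s ≤ B → g s ≤ 0) : ∀ s, b ≤ s → s ≤ B → g' s ≤ 0 := by
  obtain ⟨p1, p2, p3, p4⟩ := hxa
  obtain ⟨q1, q2, q3, q4⟩ := hxa1
  intro s h1 h2
  rw [hg']
  have h3 := hy s h1 h2
  have h4 := hy xa p1 p2
  by_cases h5 : xa1 ≤ s ∧ s < xa
  · have h6 := p4 s h1 h5.2
    simp only at h6
    have h7 := hR1 s xa1 q1 h5.1
    obtain ⟨r, r1, r2, r3⟩ := hR2 xa p1
    have h8 := q3 r r1 r2
    split_ifs <;> omega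
  · split_ifs <;> omega

lemma Hc_congr {b : ℤ} {m m' : Multiset Seg} (n : ℕ) : ∀ c,
    (∀ c', c ≤ c' → ∀ t, cnt m c' t = cnt m' c' t) → Hc b m n c = Hc b m' n c := by
  induction n with
  | zero => intro c _; rfl
  | succ n ih =>
    intro c h
    have h1 : Ec b m n c = Ec b m' n c := by
      funext s
      unfold Ec
      rw [ih (c + 1) (fun c' hc' => h c' (by omega)), h c le_rfl]
    funext t
    rw [Hc_succ, Hc_succ, h1, h c le_rfl]

lemma Dl_congr {b : ℤ} {m m' : Multiset Seg} (n : ℕ) : ∀ c X,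
    (∀ c', c ≤ c' → ∀ t, cnt m c' t = cnt m' c' t) → Dl b m n c X = Dl b m' n c X := by
  induction n with
  | zero => intro c X _; rfl
  | succ n ih =>
    intro c X h
    have h1 : Ec b m n c = Ec b m' n c := by
      funext s
      unfold Ec
      rw [Hc_congr n (c + 1) (fun c' hc' => h c' (by omega)), h c le_rfl]
    rw [Dl_succ, Dl_succ, h1, ih (c + 1) _ (fun c' hc' => h c' (by omega))]

lemma dl_col {p q : Seg} (h : p.1 ≠ q.1) : dl p q = 0 := by
  unfold dl
  rw [if_neg]
  rintro rfl
  exact h rfl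

lemma Dl_col {b : ℤ} {m : Multiset Seg} (n : ℕ) : ∀ c X (Δ : Seg), Δ.1 < c →
    Dl b m n c X Δ = 0 := by
  induction n with
  | zero =>
    intro c X Δ h
    exact dl_col (by simp only; omega)
  | succ n ih =>
    intro c X Δ h
    rw [Dl_succ]
    split_ifs
    · exact dl_col (by simp only; omega)
    · simp only [Pi.add_apply, Pi.sub_apply]
      rw [ih _ _ _ (by omega), dl_col (by simp only; omega), dl_col (by simp only; omega)]
      rfl

lemma Dl_two {b : ℤ} {m : Multiset Seg} (hR : Rng b m) (n : ℕ) {c X x x1 : ℤ} (hX : b ≤ X)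
    (h1 : IsAM (Ec b m (n + 1) c) b X x) (h2 : IsAM (Ec b m n (c + 1)) b x x1) :
    Dl b m (n + 2) c X = dl (c, x) - dl (c + 1, x) +
      (dl (c + 1, x1) - dl (c + 1 + 1, x1) + Dl b m n (c + 1 + 1) x1) := by
  rw [Dl_eager hR (n + 1) c X hX, am_eq h1, Dl_eager hR n (c + 1) x h1.1, am_eq h2]

lemma Ec_two (b : ℤ) (m : Multiset Seg) (n : ℕ) (c : ℤ) :
    Ec b m (n + 1) c = fun s => Ec b m n (c + 1) (am (Ec b m n (c + 1)) b s) + gg m c s := by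
  funext s
  rw [Ec, Hc_succ]
  unfold gg
  omega

lemma cnt_of_count {P Q : Multiset Seg} {c : ℤ} (hP : IsMS P) (hQ : IsMS Q)
    (h : ∀ Δ : Seg, Δ.1 = c → Δ.1 ≤ Δ.2 → P.count Δ = Q.count Δ) (t : ℤ) :
    cnt P c t = cnt Q c t := by
  unfold cnt
  congr 2
  ext Δ
  rw [Multiset.count_filter, Multiset.count_filter]
  split_ifs with hc
  · by_cases hv : Δ.1 ≤ Δ.2
    · exact h Δ hc.1 hv
    · rw [Multiset.count_eq_zero_of_notMem (fun h' => hv (hP Δ h')),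
        Multiset.count_eq_zero_of_notMem (fun h' => hv (hQ Δ h'))]
  · rfl

lemma ext_of_count {P Q : Multiset Seg} (hP : IsMS P) (hQ : IsMS Q)
    (h : ∀ Δ : Seg, Δ.1 ≤ Δ.2 → ((P.count Δ : ℕ) : ℤ) = Q.count Δ) : P = Q := by
  ext Δ
  by_cases hv : Δ.1 ≤ Δ.2
  · exact_mod_cast h Δ hv
  · rw [Multiset.count_eq_zero_of_notMem (fun h' => hv (hP Δ h')),
      Multiset.count_eq_zero_of_notMem (fun h' => hv (hQ Δ h'))]

lemma add_isMS {P : Multiset Seg} (hP : IsMS P) {x y : ℤ} (h : x ≤ y) : IsMS (P + {(x, y)}) := by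
  have := pushSeg_isMS hP x y
  unfold pushSeg at this
  rwa [if_pos h] at this

lemma count_add_dl (P : Multiset Seg) (p Δ : Seg) :
    (((P + {p}).count Δ : ℕ) : ℤ) = P.count Δ + dl p Δ := by
  rw [Multiset.count_add, Multiset.count_singleton]
  unfold dl
  by_cases h : Δ = p
  · simp [h]
  · rw [if_neg h, if_neg (fun h' => h h'.symm)]; simp

lemma count_erase_dl {P : Multiset Seg} {p : Seg} (hp : p ∈ P) (Δ : Seg) :
    (((P.erase p).count Δ : ℕ) : ℤ) = P.count Δ - dl p Δ := by
  have := count_add_dl (P.erase p) p Δ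
  rw [add_comm (P.erase p), Multiset.singleton_add, Multiset.cons_erase hp] at this
  omega

lemma am_R (D : ℤ → ℤ) (b : ℤ) :
    (∀ s r, b ≤ r → r ≤ s → D r ≤ D (am D b s)) ∧
    (∀ s, b ≤ s → ∃ r, b ≤ r ∧ r ≤ s ∧ D (am D b s) = D r) := by
  constructor
  · intro s r h1 h2
    exact (am_spec D (by omega : b ≤ s)).2.2.1 r h1 h2
  · intro s h
    have := am_spec D h
    exact ⟨am D b s, this.1, this.2.1, rfl⟩

lemma exists_bound (m : Multiset Seg) (b : ℤ) : ∃ B, b ≤ B ∧ ∀ Δ ∈ m, Δ.2 ≤ B := by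
  induction m using Multiset.induction_on with
  | empty => exact ⟨b, le_rfl, by simp⟩
  | cons p s ih =>
    obtain ⟨B, h1, h2⟩ := ih
    refine ⟨max B p.2, by omega, ?_⟩
    intro Δ hΔ
    rw [Multiset.mem_cons] at hΔ
    rcases hΔ with rfl | hΔ
    · omega
    · have := h2 Δ hΔ; omega

/-- for `b > a` and `m` in good range for `[a,b]`,
`ℐ^Lang_{[a,b]} ∘ ℐ_{[a]}(m) = ℐ_{[a]} ∘ ℐ^Lang_{[a,b]}(m)`. -/
theorem stmt5 (m : Multiset Seg) (hm : IsMS m) (a b : ℤ) (hab : a < b)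
    (hgr : GoodRange m a b) :
    ILang a b (Irho a m) = Irho a (ILang a b m) := by
  have hgm : ∀ Δ ∈ m, a ≤ Δ.1 ∧ Δ.1 ≤ b + 1 ∧ b ≤ Δ.2 := by
    intro Δ hΔ
    rw [← show mRange m a b = m from hgr] at hΔ
    exact (Multiset.mem_filter.mp hΔ).2
  have hR : Rng b m := fun Δ hΔ => (hgm Δ hΔ).2
  obtain ⟨B, hB, hmB⟩ := exists_bound m b
  obtain ⟨n, hn⟩ : ∃ n : ℕ, a + ((n + 2 : ℕ) : ℤ) = b + 2 :=
    ⟨(b - a).toNat, by push_cast; omega⟩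
  have hxa := am_spec (Ec b m (n + 1) a) hB
  set xa := am (Ec b m (n + 1) a) b B with hxadef
  have hxa1 := am_spec (Ec b m n (a + 1)) hxa.1
  set xa1 := am (Ec b m n (a + 1)) b xa with hxa1def
  have hDl := Dl_two hR n hB hxa hxa1
  -- counts of `ILang m`
  have hcount : ∀ Δ : Seg, Δ.1 ≤ Δ.2 → (((ILang a b m).count Δ : ℕ) : ℤ) =
      m.count Δ + Dl b m (n + 2) a B Δ := by
    intro Δ hΔ
    have := ILang_count (m := m) hn hB (by rw [show mRange m a b = m from hgr]; exact hmB) Δ hΔ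
    rwa [show mRange m a b = m from hgr] at this
  have hMS' := ILang_isMS hm a b
  set m' := ILang a b m with hm'
  have hxab := hxa.1
  have hxaB := hxa.2.1
  have hxa1b := hxa1.1
  have hxa1le := hxa1.2.1
  have hca : ∀ Δ : Seg, Δ.1 = a → Δ.1 ≤ Δ.2 → m'.count Δ = (m + {(a, xa)}).count Δ := by
    intro Δ h1 h2
    have e1 := hcount Δ h2
    have e2 := count_add_dl m (a, xa) Δ
    rw [hDl] at e1
    simp only [Pi.add_apply, Pi.sub_apply] at e1
    rw [Dl_col n (a + 1 + 1) xa1 Δ (by omega), dl_col (p := (a + 1, xa)) (by simp only; omega),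
      dl_col (p := (a + 1, xa1)) (by simp only; omega),
      dl_col (p := (a + 1 + 1, xa1)) (by simp only; omega)] at e1
    omega
  have hca1 : ∀ Δ : Seg, Δ.1 = a + 1 → Δ.1 ≤ Δ.2 →
      (m' + {(a + 1, xa)}).count Δ = (m + {(a + 1, xa1)}).count Δ := by
    intro Δ h1 h2
    have e1 := hcount Δ h2
    have e2 := count_add_dl m (a + 1, xa1) Δ
    have e3 := count_add_dl m' (a + 1, xa) Δ
    rw [hDl] at e1
    simp only [Pi.add_apply, Pi.sub_apply] at e1
    rw [Dl_col n (a + 1 + 1) xa1 Δ (by omega), dl_col (p := (a, xa)) (by simp only; omega),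
      dl_col (p := (a + 1 + 1, xa1)) (by simp only; omega)] at e1
    omega
  have hcnta := cnt_of_count hMS' (add_isMS hm (by omega : a ≤ xa)) hca
  have hcnta1 := cnt_of_count (add_isMS hMS' (by omega : a + 1 ≤ xa))
    (add_isMS hm (by omega : a + 1 ≤ xa1)) hca1
  have hg' : ∀ s, gg m' a s = gg m a s + (if xa1 ≤ s then 1 else 0) - (if xa ≤ s then 1 else 0)
      - (if xa < s then 1 else 0) := by
    intro s
    have e1 := hcnta (s - 1)
    have e2 := hcnta1 s
    simp only [cnt_add, cnt_singleton, true_and] at e1 e2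
    unfold gg
    split_ifs at * <;> omega
  have hb0' : ∀ y, (a, y) ∈ m' → b ≤ y ∧ y ≤ B := by
    intro y hy
    have h1 := hca (a, y) rfl (hMS' _ hy)
    have h2 : (a, y) ∈ m + {(a, xa)} := by
      rw [← Multiset.count_pos, ← h1]
      exact Multiset.count_pos.mpr hy
    rw [Multiset.mem_add, Multiset.mem_singleton] at h2
    rcases h2 with h2 | h2
    · exact ⟨(hR _ h2).2, hmB _ h2⟩
    · have := congrArg Prod.snd h2
      simp only at this
      omega
  have hb1' : ∀ y, (a + 1, y) ∈ m' → b ≤ y ∧ y ≤ B := by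
    intro y hy
    have h1 := hca1 (a + 1, y) rfl (hMS' _ hy)
    have h2 : (a + 1, y) ∈ m + {(a + 1, xa1)} := by
      rw [← Multiset.count_pos, ← h1]
      exact Multiset.count_pos.mpr (Multiset.mem_add.mpr (Or.inl hy))
    rw [Multiset.mem_add, Multiset.mem_singleton] at h2
    rcases h2 with h2 | h2
    · exact ⟨(hR _ h2).2, hmB _ h2⟩
    · have := congrArg Prod.snd h2
      simp only at this
      omega
  have hy := am_spec (gg m a) hB
  set y := am (gg m a) b B with hydef
  have hspec := Irho_spec hab.le (fun z hz => ⟨(hR _ hz).2, hmB _ hz⟩)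
    (fun z hz => ⟨(hR _ hz).2, hmB _ hz⟩) hy
  obtain ⟨hR1, hR2⟩ := am_R (Ec b m n (a + 1)) b
  have hxa' := hxa
  rw [Ec_two] at hxa'
  rcases le_or_gt (gg m a y) 0 with hc | hc
  · -- nothing to extend
    rw [hspec.1 hc]
    have hy' := am_spec (gg m' a) hB
    have hneg := core0 hR1 hR2 hg' hxa' hxa1
      (fun s h1 h2 => (hy.2.2.1 s h1 h2).trans hc) _ hy'.1 hy'.2.1
    rw [(Irho_spec hab.le hb0' hb1' hy').1 hneg]
    have hmr : mRange (m + {(a, a)}) a b = m := by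
      unfold mRange
      rw [Multiset.filter_add, Multiset.filter_singleton, if_neg (by simp only; omega)]
      rw [Multiset.empty_eq_zero, add_zero]
      exact hgr
    apply ext_of_count (ILang_isMS (add_isMS hm le_rfl) a b) (add_isMS hMS' le_rfl)
    intro Δ hΔ
    have e1 := ILang_count (m := m + {(a, a)}) hn hB (by rw [hmr]; exact hmB) Δ hΔ
    rw [hmr] at e1
    have e2 := hcount Δ hΔ
    have e3 := count_add_dl m (a, a) Δ
    have e4 := count_add_dl m' (a, a) Δ
    omega
  · obtain ⟨hmem, hI⟩ := hspec.2 hc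
    rw [hI]
    have hyb := hy.1
    have hyB := hy.2.1
    set mt := m.erase (a + 1, y) + {(a, y)} with hmt
    have hmtmem : ∀ Δ ∈ mt, Δ ∈ m ∨ Δ = (a, y) := by
      intro Δ hΔ
      rw [hmt, Multiset.mem_add, Multiset.mem_singleton] at hΔ
      exact hΔ.imp Multiset.mem_of_mem_erase id
    have hmtMS : IsMS mt := add_isMS (erase_isMS hm _) (by omega)
    have hmtr : mRange mt a b = mt := by
      apply Multiset.filter_eq_self.mpr
      intro Δ hΔ
      rcases hmtmem Δ hΔ with h | rfl
      · exact hgm Δ h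
      · simp only; omega
    have hmtB : ∀ Δ ∈ mt, Δ.2 ≤ B := by
      intro Δ hΔ
      rcases hmtmem Δ hΔ with h | rfl
      · exact hmB Δ h
      · exact hyB
    have hmtR : Rng b mt := by
      intro Δ hΔ
      rcases hmtmem Δ hΔ with h | rfl
      · exact hR Δ h
      · simp only; omega
    have hmteq : mt + {(a + 1, y)} = m + {(a, y)} := by
      rw [hmt, add_right_comm, add_comm (m.erase _), Multiset.singleton_add,
        Multiset.cons_erase hmem]
    have hcmt : ∀ c t, cnt mt c t = cnt m c t + (if a = c ∧ y ≤ t then 1 else 0) -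
        (if a + 1 = c ∧ y ≤ t then 1 else 0) := by
      intro c t
      have := congrArg (fun z => cnt z c t) hmteq
      simp only [cnt_add, cnt_singleton] at this
      omega
    have hhigh : ∀ c', a + 1 + 1 ≤ c' → ∀ t, cnt mt c' t = cnt m c' t := by
      intro c' h t
      rw [hcmt, if_neg (by omega), if_neg (by omega)]
      omega
    have hD' : ∀ r, Ec b mt n (a + 1) r = Ec b m n (a + 1) r + if y < r then 1 else 0 := by
      intro r
      unfold Ec
      rw [Hc_congr n _ hhigh, hcmt, if_neg (by omega)]
      simp only [true_and]
      split_ifs <;> omega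
    have hgt : ∀ s, gg mt a s = gg m a s - (if y ≤ s then 1 else 0) -
        (if y < s then 1 else 0) := by
      intro s
      unfold gg
      rw [hcmt, hcmt, if_neg (by omega : ¬ (a = a + 1 ∧ y ≤ s)),
        if_neg (by omega : ¬ (a + 1 = a ∧ y ≤ s - 1))]
      simp only [true_and]
      split_ifs <;> omega
    obtain ⟨hT1, hT2⟩ := am_R (Ec b mt n (a + 1)) b
    obtain ⟨xt, y', k1, k2, k3, k4, k5⟩ := core hR1 hR2 hT1 hT2 hD' hgt hg' hxa' hxa1 hy
    rw [← Ec_two] at k1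
    have hDlt := Dl_two hmtR n hB k1 k2
    rw [Dl_congr n _ _ hhigh] at hDlt
    obtain ⟨hmem', hI'⟩ := (Irho_spec hab.le hb0' hb1' k3).2 (by omega)
    rw [hI']
    have hy'b := k3.1
    apply ext_of_count (ILang_isMS hmtMS a b)
      (add_isMS (erase_isMS hMS' _) (by omega : a ≤ y'))
    intro Δ hΔ
    have e1 := ILang_count (m := mt) hn hB (by rw [hmtr]; exact hmtB) Δ hΔ
    rw [hmtr, hDlt] at e1
    have e2 := hcount Δ hΔ
    rw [hDl] at e2
    have e3 := count_add_dl (m'.erase (a + 1, y')) (a, y') Δ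
    have e4 := count_erase_dl hmem' Δ
    have e5 := count_add_dl (m.erase (a + 1, y)) (a, y) Δ
    have e6 := count_erase_dl hmem Δ
    rw [← hmt] at e5
    simp only [Pi.add_apply, Pi.sub_apply] at e1 e2
    rcases k5 with ⟨h1, h2⟩ | ⟨h1, h2⟩
    · rw [h2] at e1
      rw [h1] at e5 e6
      omega
    · rw [h1] at e1
      rw [h2] at e3 e4 ⊢
      omega

end Multiseg
end

section
/- Let m be a nonempty multisegment, let a be the smallest and b the largest integer belonging to some segment of m. Set ε_a = ε_{[a]}(m) and, recursively for a < t ≤ b, ε_t = ε_{[t]}((D_{[t−1]})^{ε_{t−1}} ∘ ⋯ ∘ (D_{[a]})^{ε_a}(m)). Define 𝔡(m) as follows: set m₁ = m and m_{i+1} = mᵢ − Us(mᵢ) until m_k = Us(m_k); writing Us(mᵢ) = {Δ_{i,1} ≺ ⋯ ≺ Δ_{i,r_i}} with Δ_{i,j} = [x_{i,j}, y_{i,j}], the non-free section is nf(Δ_{i,j}) = [x_{i,j+1} − 1, y_{i,j}] for j < r_i and nf(Δ_{i,r_i}) = ∅, and 𝔡(m) = Σ_{i=1}^k Σ_{j=1}^{r_i}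 nf(Δ_{i,j}). Then (D_{[b]})^{ε_b} ∘ ⋯ ∘ (D_{[a]})^{ε_a}(m) = 𝔡(m); in particular none of the derivatives in this composition equals ∞. -/
namespace Multiseg

theorem msetMax_eq_some {s : Multiset ℤ} {y : ℤ} :
    msetMax s = some y ↔ y ∈ s ∧ ∀ x ∈ s, x ≤ y := by
  unfold msetMax
  split_ifs with h
  · simp [h]
  · rw [Option.some_inj, Finset.max'_eq_iff]
    simp

theorem msetMax_eq_none {s : Multiset ℤ} : msetMax s = none ↔ s = 0 := by
  unfold msetMax
  split_ifs with h <;> simp [h]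

theorem msetMin_eq_some {s : Multiset ℤ} {y : ℤ} :
    msetMin s = some y ↔ y ∈ s ∧ ∀ x ∈ s, y ≤ x := by
  unfold msetMin
  split_ifs with h
  · simp [h]
  · rw [Option.some_inj, Finset.min'_eq_iff]
    simp

theorem msetMin_eq_none {s : Multiset ℤ} : msetMin s = none ↔ s = 0 := by
  unfold msetMin
  split_ifs with h <;> simp [h]

theorem exists_max_cons {s : Multiset ℤ} (h : s ≠ 0) :
    ∃ y s', s = y ::ₘ s' ∧ ∀ x ∈ s', x ≤ y := by
  rcases hy : msetMax s with _ | y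
  · exact absurd (msetMax_eq_none.1 hy) h
  · obtain ⟨h1, h2⟩ := msetMax_eq_some.1 hy
    obtain ⟨s', rfl⟩ := Multiset.exists_cons_of_mem h1
    exact ⟨y, s', rfl, fun x hx => h2 x (Multiset.mem_cons_of_mem hx)⟩

theorem max_induction {P : Multiset ℤ → Prop} (h0 : P 0)
    (hs : ∀ y A, (∀ x ∈ A, x ≤ y) → P A → P (y ::ₘ A)) (A : Multiset ℤ) : P A := by
  induction hn : A.card generalizing A with
  | zero => rw [Multiset.card_eq_zero.1 hn]; exact h0
  | succ n ih =>
    obtain ⟨y, A', rfl, h⟩ := exists_max_cons (s := A) (by rintro rfl; simp at hn)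
    exact hs y A' h (ih A' (by simpa using hn))

/-- Either everything in `B` is at most `y`, or `B` has a maximum exceeding `y`. -/
theorem max_cases (B : Multiset ℤ) (y : ℤ) :
    (∀ x ∈ B, x ≤ y) ∨ ∃ z B', B = z ::ₘ B' ∧ (∀ x ∈ B', x ≤ z) ∧ y < z := by
  by_cases h : ∀ x ∈ B, x ≤ y
  · exact Or.inl h
  · right
    push Not at h
    obtain ⟨w, hw, hyw⟩ := h
    obtain ⟨z, B', rfl, hz⟩ := exists_max_cons (s := B) (by rintro rfl; simp at hw)
    refine ⟨z, B', rfl, hz, ?_⟩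
    rcases Multiset.mem_cons.1 hw with rfl | hw
    · exact hyw
    · exact lt_of_lt_of_le hyw (hz w hw)

/-! ### Greedy matching -/

/-- The unmatched part of `A` after matching (from the top) with larger elements of `B`. -/
def guF : ℕ → Multiset ℤ → Multiset ℤ → Multiset ℤ
  | 0, _, _ => 0
  | n + 1, A, B =>
    match msetMax A with
    | none => 0
    | some y =>
      match msetMax B with
      | none => y ::ₘ guF n (A.erase y) B
      | some z => if y < z then guF n (A.erase y) (B.erase z) else y ::ₘ guF n (A.erase y) B

def gu (A B : Multiset ℤ) : Multiset ℤ := guF A.card A B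

@[simp] theorem gu_zero (B : Multiset ℤ) : gu 0 B = 0 := rfl

theorem gu_skip {y : ℤ} {A B : Multiset ℤ} (hA : ∀ x ∈ A, x ≤ y) (hB : ∀ x ∈ B, x ≤ y) :
    gu (y ::ₘ A) B = y ::ₘ gu A B := by
  have h1 : msetMax (y ::ₘ A) = some y := msetMax_eq_some.2 (by simpa using hA)
  unfold gu
  rw [Multiset.card_cons, guF, h1]
  rcases h2 : msetMax B with _ | z
  · simp
  · have := hB z (msetMax_eq_some.1 h2).1
    simp [not_lt.2 this]

theorem gu_match {y z : ℤ} {A B : Multiset ℤ} (hA : ∀ x ∈ A, x ≤ y) (hB : ∀ x ∈ B, x ≤ z)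
    (hyz : y < z) : gu (y ::ₘ A) (z ::ₘ B) = gu A B := by
  have h1 : msetMax (y ::ₘ A) = some y := msetMax_eq_some.2 (by simpa using hA)
  have h2 : msetMax (z ::ₘ B) = some z := msetMax_eq_some.2 (by simpa using hB)
  unfold gu
  rw [Multiset.card_cons, guF, h1, h2]
  simp [hyz]

theorem gu_le (A : Multiset ℤ) : ∀ B, gu A B ≤ A := by
  induction A using max_induction with
  | h0 => simp
  | hs y A hA ih =>
    intro B
    rcases max_cases B y with h | ⟨z, B', rfl, hz, hyz⟩
    · rw [gu_skip hA h]
      exact (Multiset.cons_le_cons_iff y).2 (ih B)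
    · rw [gu_match hA hz hyz]
      exact (ih B').trans (Multiset.le_cons_self _ _)

/-- If everything in `B` is below everything in `A`, nothing is matched. -/
theorem gu_none (A : Multiset ℤ) : ∀ B, (∀ x ∈ A, ∀ z ∈ B, z ≤ x) → gu A B = A := by
  induction A using max_induction with
  | h0 => simp
  | hs y A hA ih =>
    intro B h
    rw [gu_skip hA (h y (by simp)), ih B (fun x hx => h x (by simp [hx]))]

/-- The greedy step of the `tds` process does not change the unmatched part. -/
theorem gu_step (A : Multiset ℤ) : ∀ (B : Multiset ℤ) (y z : ℤ), y < z → (∀ x ∈ B, x ≤ z) →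
    (∀ x ∈ A, x < z → x ≤ y) → gu (y ::ₘ A) (z ::ₘ B) = gu A B := by
  induction A using max_induction with
  | h0 =>
    intro B y z hyz hB _
    rw [gu_match (by simp) hB hyz]
  | hs w A hA ih =>
    intro B y z hyz hB h
    by_cases hw : w < z
    · have hwy := h w (by simp) hw
      rw [gu_match _ hB hyz]
      intro x hx
      rcases Multiset.mem_cons.1 hx with rfl | hx
      · exact hwy
      · exact (hA x hx).trans hwy
    · rw [Multiset.cons_swap, gu_skip, gu_skip hA, ih B y z hyz hB]
      · exact fun x hx => h x (by simp [hx])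
      · exact fun x hx => (hB x hx).trans (by omega)
      · intro x hx
        rcases Multiset.mem_cons.1 hx with rfl | hx
        · omega
        · exact hA x hx
      · intro x hx
        rcases Multiset.mem_cons.1 hx with rfl | hx
        · omega
        · exact (hB x hx).trans (by omega)

/-- Adding to `B` an element below all unmatched ones changes nothing. -/
theorem gu_add (A : Multiset ℤ) : ∀ (B : Multiset ℤ) (y : ℤ), (∀ u ∈ gu A B, y ≤ u) →
    gu A (y ::ₘ B) = gu A B := by
  induction A using max_induction with
  | h0 => simp
  | hs w A hA ih =>
    intro B y h
    rcases max_cases B w with hB | ⟨z, B', rfl, hz, hwz⟩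
    · rw [gu_skip hA hB] at h ⊢
      have hyw := h w (by simp)
      rw [gu_skip hA, ih B y (fun u hu => h u (by simp [hu]))]
      intro x hx
      rcases Multiset.mem_cons.1 hx with rfl | hx
      · exact hyw
      · exact hB x hx
    · rw [gu_match hA hz hwz] at h ⊢
      by_cases hyz : y ≤ z
      · rw [Multiset.cons_swap, gu_match hA _ hwz, ih B' y h]
        intro x hx
        rcases Multiset.mem_cons.1 hx with rfl | hx
        · exact hyz
        · exact hz x hx
      · have h0 : gu A B' = 0 := by
          by_contra hne
          obtain ⟨u, hu⟩ := Multiset.exists_mem_of_ne_zero hne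
          have h1 := h u hu
          have h2 := hA u (Multiset.mem_of_le (gu_le A B') hu)
          omega
        rw [gu_match hA _ (by omega), ih B' z (by simp [h0])]
        intro x hx
        rcases Multiset.mem_cons.1 hx with rfl | hx
        · omega
        · exact (hz x hx).trans (by omega)

/-- Moving the smallest unmatched element from `A` to `B`. -/
theorem gu_move (A : Multiset ℤ) : ∀ (B : Multiset ℤ) (y : ℤ), y ∈ gu A B →
    (∀ u ∈ gu A B, y ≤ u) → gu (A.erase y) (y ::ₘ B) = (gu A B).erase y := by
  induction A using max_induction with
  | h0 => simp
  | hs w A hA ih =>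
    intro B y hy h
    rcases max_cases B w with hB | ⟨z, B', rfl, hz, hwz⟩
    · rw [gu_skip hA hB] at hy h ⊢
      by_cases hyA : y ∈ gu A B
      · have hyA' := Multiset.mem_of_le (gu_le A B) hyA
        have hyw := hA y hyA'
        rw [Multiset.erase_cons_tail_of_mem hyA', Multiset.erase_cons_tail_of_mem hyA,
          gu_skip, ih B y hyA (fun u hu => h u (by simp [hu]))]
        · exact fun x hx => hA x (Multiset.mem_of_mem_erase hx)
        · intro x hx
          rcases Multiset.mem_cons.1 hx with rfl | hx
          · exact hyw
          · exact hB x hx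
      · have hyw : y = w := by
          rcases Multiset.mem_cons.1 hy with h | h
          · exact h
          · exact absurd h hyA
        subst hyw
        rw [Multiset.erase_cons_head, Multiset.erase_cons_head,
          gu_add A B y (fun u hu => h u (by simp [hu]))]
    · rw [gu_match hA hz hwz] at hy h ⊢
      have hyA' := Multiset.mem_of_le (gu_le A B') hy
      have hyw := hA y hyA'
      rw [Multiset.erase_cons_tail_of_mem hyA', Multiset.cons_swap, gu_match _ _ hwz,
        ih B' y hy h]
      · exact fun x hx => hA x (Multiset.mem_of_mem_erase hx)
      · intro x hx
        rcases Multiset.mem_cons.1 hx with rfl | hx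
        · omega
        · exact hz x hx

/-! ### The `ρ`-derivative in terms of greedy matching -/

/-- End points of the segments starting at `i`. -/
def ends (m : Multiset Seg) (i : ℤ) : Multiset ℤ := (startAt m i).map Prod.snd

@[simp] theorem ends_zero (i : ℤ) : ends 0 i = 0 := rfl

theorem ends_add (m n : Multiset Seg) (i : ℤ) : ends (m + n) i = ends m i + ends n i := by
  simp [ends, startAt]

theorem ends_cons_self (m : Multiset Seg) (i y : ℤ) :
    ends ((i, y) ::ₘ m) i = y ::ₘ ends m i := by
  simp [ends, startAt]

theorem ends_cons_ne (m : Multiset Seg) {i j : ℤ} (y : ℤ) (h : j ≠ i) :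
    ends ((j, y) ::ₘ m) i = ends m i := by
  simp [ends, startAt, h]

theorem mem_ends {m : Multiset Seg} {i y : ℤ} : y ∈ ends m i ↔ (i, y) ∈ m := by
  simp [ends, startAt]

theorem ends_eq_zero {m : Multiset Seg} {i : ℤ} (h : ∀ Δ ∈ m, Δ.1 ≠ i) : ends m i = 0 := by
  refine Multiset.eq_zero_of_forall_notMem fun y hy => ?_
  exact h _ (mem_ends.1 hy) rfl

theorem ends_map_self (A : Multiset ℤ) (i : ℤ) : ends (A.map (Prod.mk i)) i = A := by
  simp [ends, startAt, Multiset.filter_map]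

theorem ends_map_ne (A : Multiset ℤ) {i j : ℤ} (h : j ≠ i) : ends (A.map (Prod.mk j)) i = 0 := by
  apply ends_eq_zero
  simp [h]

theorem startAt_eq (m : Multiset Seg) (i : ℤ) : startAt m i = (ends m i).map (Prod.mk i) := by
  unfold ends
  rw [Multiset.map_map]
  conv_lhs => rw [← Multiset.map_id (startAt m i)]
  apply Multiset.map_congr rfl
  intro x hx
  have := (Multiset.mem_filter.1 hx).2
  simp [← this]

theorem IsMS.mono {m n : Multiset Seg} (h : IsMS m) (hn : n ≤ m) : IsMS n :=
  fun Δ hΔ => h Δ (Multiset.mem_of_le hn hΔ)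

theorem tdsIterF_ends (c : ℤ) : ∀ (n : ℕ) (m : Multiset Seg), IsMS m → m.card ≤ n →
    ends (tdsIterF c n m) c = gu (ends m c) (ends m (c + 1)) := by
  intro n
  induction n with
  | zero =>
    intro m _ hc
    have : m = 0 := by simpa using hc
    subst this
    rfl
  | succ n ih =>
    intro m hm hc
    rw [tdsIterF]
    unfold tdsStep longStart
    rcases hz : msetMax ((startAt m (c + 1)).map Prod.snd) with _ | z
    · have : ends m (c + 1) = 0 := msetMax_eq_none.1 hz
      simp only [Option.map_none]
      rw [gu_none]
      simp [this]
    · simp only [Option.map_some]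
      obtain ⟨hz1, hz2⟩ := msetMax_eq_some.1 hz
      change z ∈ ends m (c + 1) at hz1
      change ∀ x ∈ ends m (c + 1), x ≤ z at hz2
      rcases hy : msetMax (((startAt m c).filter fun Δ => Prec Δ (c + 1, z)).map Prod.snd)
        with _ | y
      · have h0 := msetMax_eq_none.1 hy
        simp only
        rw [gu_none]
        intro x hx w hw
        refine (hz2 w hw).trans ?_
        by_contra hlt
        have hx' := mem_ends.1 hx
        have hcx := hm _ hx'
        have : x ∈ ((startAt m c).filter fun Δ => Prec Δ (c + 1, z)).map Prod.snd := by
          simp only [Multiset.mem_map, Multiset.mem_filter, startAt]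
          exact ⟨(c, x), ⟨⟨hx', rfl⟩, by unfold Prec; simp only at hcx ⊢; omega⟩, rfl⟩
        rw [h0] at this
        simp at this
      · obtain ⟨hy1, hy2⟩ := msetMax_eq_some.1 hy
        simp only
        have hyz : (c, y) ∈ m ∧ y < z := by
          simp only [Multiset.mem_map, Multiset.mem_filter, startAt] at hy1
          obtain ⟨⟨p, q⟩, ⟨⟨h1, h2⟩, h3⟩, h4⟩ := hy1
          simp only at h2 h3 h4
          subst h2 h4
          exact ⟨h1, h3.2.1⟩
        obtain ⟨hym, hyz⟩ := hyz
        have hy3 : ∀ x ∈ ends m c, x < z → x ≤ y := by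
          intro x hx hlt
          have hx' := mem_ends.1 hx
          have hcx := hm _ hx'
          apply hy2
          simp only [Multiset.mem_map, Multiset.mem_filter, startAt]
          exact ⟨(c, x), ⟨⟨hx', rfl⟩, by unfold Prec; simp only at hcx ⊢; omega⟩, rfl⟩
        obtain ⟨m1, rfl⟩ := Multiset.exists_cons_of_mem hym
        have hzm : (c + 1, z) ∈ m1 := by
          have := mem_ends.1 hz1
          simpa using this
        obtain ⟨m2, rfl⟩ := Multiset.exists_cons_of_mem hzm
        rw [Multiset.erase_cons_head, Multiset.erase_cons_head]
        have hc2 : m2.card ≤ n := by simp at hc; omega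
        have hm2 : IsMS m2 := hm.mono
          ((Multiset.le_cons_self _ _).trans (Multiset.le_cons_self _ _))
        rw [ih m2 hm2 hc2]
        have e1 : ends ((c, y) ::ₘ (c + 1, z) ::ₘ m2) c = y ::ₘ ends m2 c := by
          rw [ends_cons_self, ends_cons_ne _ _ (by omega)]
        have e2 : ends ((c, y) ::ₘ (c + 1, z) ::ₘ m2) (c + 1) = z ::ₘ ends m2 (c + 1) := by
          rw [ends_cons_ne _ _ (by omega), ends_cons_self]
        rw [e1] at hy3
        rw [e2] at hz2
        rw [e1, e2, gu_step _ _ _ _ hyz]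
        · exact fun x hx => hz2 x (by simp [hx])
        · exact fun x hx => hy3 x (by simp [hx])

theorem tdsIter_ends (c : ℤ) {m : Multiset Seg} (hm : IsMS m) :
    ends (tdsIter c m) c = gu (ends m c) (ends m (c + 1)) :=
  tdsIterF_ends c _ m hm le_rfl

theorem epsA_eq (c : ℤ) {m : Multiset Seg} (hm : IsMS m) :
    epsA c m = (gu (ends m c) (ends m (c + 1))).card := by
  rw [← tdsIter_ends c hm]
  simp [epsA, ends]

/-- The nonvoid truncations `[t+1,y]` of the segments `[t,y]`, `y ∈ U`. -/
def pr (t : ℤ) (U : Multiset ℤ) : Multiset Seg := (U.filter fun y => t < y).map (Prod.mk (t + 1))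

theorem pr_cons (t y : ℤ) (U : Multiset ℤ) : pr t (y ::ₘ U) = pr t {y} + pr t U := by
  unfold pr
  rw [← Multiset.singleton_add, Multiset.filter_add, Multiset.map_add]

theorem pushSeg_eq (t y : ℤ) (n : Multiset Seg) : pushSeg n (t + 1) y = n + pr t {y} := by
  unfold pushSeg pr
  by_cases h : t < y
  · rw [if_pos (by omega), Multiset.filter_singleton, if_pos h]; simp
  · rw [if_neg (by omega), Multiset.filter_singleton, if_neg h]; simp

theorem ends_pr (t : ℤ) (U : Multiset ℤ) : ends (pr t U) (t + 1) = U.filter fun y => t < y :=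
  ends_map_self _ _

theorem ends_pr_ne (t i : ℤ) (U : Multiset ℤ) (h : t + 1 ≠ i) : ends (pr t U) i = 0 :=
  ends_map_ne _ h

theorem DrhoPow_eq (t : ℤ) : ∀ (k : ℕ) (X : Multiset Seg) (U : Multiset ℤ) (m : Multiset Seg),
    IsMS m → m = X + U.map (Prod.mk t) → gu (ends m t) (ends m (t + 1)) = U → U.card = k →
    DrhoPow t k m = some (X + pr t U) := by
  intro k
  induction k with
  | zero =>
    intro X U m _ hX _ hk
    have : U = 0 := by simpa using hk
    subst this
    simp [DrhoPow, hX, pr]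
  | succ k ih =>
    intro X U m hm hX hU hk
    have hUne : U ≠ 0 := by rintro rfl; simp at hk
    rcases hy : msetMin U with _ | y
    · exact absurd (msetMin_eq_none.1 hy) hUne
    obtain ⟨hy1, hy2⟩ := msetMin_eq_some.1 hy
    have hD : Drho t m = some (m.erase (t, y) + pr t {y}) := by
      unfold Drho shortStart
      have := tdsIter_ends t hm
      rw [hU] at this
      unfold ends at this
      rw [this, hy]
      simp [pushSeg_eq]
    rw [DrhoPow, hD, Option.bind_some]
    obtain ⟨U', rfl⟩ := Multiset.exists_cons_of_mem hy1
    have hme : m = (t, y) ::ₘ (X + U'.map (Prod.mk t)) := by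
      rw [hX]; simp
    have hm' : m.erase (t, y) = X + U'.map (Prod.mk t) := by
      rw [hme, Multiset.erase_cons_head]
    have hty : t ≤ y := hm (t, y) (by rw [hme]; simp)
    rw [hm', pr_cons, ← add_assoc]
    refine ih (X + pr t {y}) U' _ ?_ (by abel) ?_ (by simpa using hk)
    · intro Δ hΔ
      rcases Multiset.mem_add.1 hΔ with h | h
      · exact hm Δ (by rw [hme]; exact Multiset.mem_cons_of_mem h)
      · simp only [pr, Multiset.mem_map, Multiset.mem_filter, Multiset.mem_singleton] at h
        obtain ⟨q, ⟨rfl, h2⟩, rfl⟩ := h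
        simp only; omega
    · set N := X + U'.map (Prod.mk t) with hN
      have eA : ends m t = y ::ₘ ends N t := by rw [hme, ends_cons_self]
      have eB : ends m (t + 1) = ends N (t + 1) := by rw [hme, ends_cons_ne _ _ (by omega)]
      rw [eA, eB] at hU
      have hmv := gu_move (y ::ₘ ends N t) (ends N (t + 1)) y (by rw [hU]; exact hy1)
        (by rw [hU]; exact hy2)
      rw [hU, Multiset.erase_cons_head, Multiset.erase_cons_head] at hmv
      rw [ends_add N, ends_add N, ends_pr, ends_pr_ne _ _ _ (by omega), add_zero,
        Multiset.filter_singleton]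
      split_ifs with hlt
      · rw [add_comm, Multiset.singleton_add, hmv]
      · have : y = t := by omega
        subst this
        rw [← hmv, gu_add]
        · simp
        · intro u hu
          have := Multiset.mem_of_le (gu_le _ _) hu
          exact hm (y, u) (by rw [hme]; exact Multiset.mem_cons_of_mem (mem_ends.1 this))

/-! ### Upward sequences -/

theorem usNext_mem {n : Multiset Seg} {p Δ : Seg} (h : usNext n p = some Δ) :
    Δ ∈ n ∧ Prec p Δ := by
  unfold usNext at h
  rcases h1 : msetMin ((n.filter fun Δ => Prec p Δ).map Prod.fst) with _ | x
  · rw [h1] at h; simp at h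
  · rw [h1] at h
    simp only [Option.map_eq_some_iff] at h
    obtain ⟨y, hy, rfl⟩ := h
    have := (msetMax_eq_some.1 hy).1
    simp only [Multiset.mem_map, Multiset.mem_filter] at this
    obtain ⟨⟨p1, q1⟩, ⟨⟨h3, h4⟩, h5⟩, h6⟩ := this
    simp only at h5 h6
    subst h5 h6
    exact ⟨h3, h4⟩

theorem usNext_congr {n n' : Multiset Seg} {p p' : Seg}
    (h : n.filter (fun Δ => Prec p Δ) = n'.filter fun Δ => Prec p' Δ) :
    usNext n p = usNext n' p' := by
  unfold usNext
  rw [h]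

theorem usNext_eq_none {n : Multiset Seg} {p : Seg} (h : ∀ Δ ∈ n, ¬ Prec p Δ) :
    usNext n p = none := by
  unfold usNext
  have : n.filter (fun Δ => Prec p Δ) = 0 := Multiset.filter_eq_nil.2 h
  rw [this]
  rfl

theorem usAux_congr (f : ℕ) : ∀ (n n' : Multiset Seg) (p : Seg),
    n.filter (fun Δ => p.1 < Δ.1) = n'.filter (fun Δ => p.1 < Δ.1) →
    usAux n f p = usAux n' f p := by
  induction f with
  | zero => intros; rfl
  | succ f ih =>
    intro n n' p h
    have key : ∀ k : Multiset Seg, k.filter (fun Δ => Prec p Δ)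
        = (k.filter (fun Δ => p.1 < Δ.1)).filter (fun Δ => Prec p Δ) := by
      intro k
      rw [Multiset.filter_filter]
      exact Multiset.filter_congr fun x _ => ⟨fun h => ⟨h, h.1⟩, fun h => h.1⟩
    have h1 : usNext n p = usNext n' p := usNext_congr (by rw [key n, key n', h])
    rw [usAux, usAux, ← h1]
    rcases h2 : usNext n p with _ | Δ
    · rfl
    · simp only
      rw [ih n n' Δ]
      have hlt := (usNext_mem h2).2.1
      have key2 : ∀ k : Multiset Seg, k.filter (fun x => Δ.1 < x.1)
          = (k.filter (fun x => p.1 < x.1)).filter (fun x => Δ.1 < x.1) := by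
        intro k
        rw [Multiset.filter_filter]
        exact Multiset.filter_congr fun x _ => ⟨fun h => ⟨h, hlt.trans h⟩, fun h => h.1⟩
      rw [key2 n, key2 n', h]

theorem cons_filter_le {n : Multiset Seg} {p Δ : Seg} (h : Δ ∈ n) (hlt : p.1 < Δ.1) :
    Δ ::ₘ n.filter (fun x => Δ.1 < x.1) ≤ n.filter (fun x => p.1 < x.1) := by
  obtain ⟨k, rfl⟩ := Multiset.exists_cons_of_mem h
  rw [Multiset.filter_cons_of_neg (p := fun x : Seg => Δ.1 < x.1) _ (lt_irrefl _),
    Multiset.filter_cons_of_pos (p := fun x : Seg => p.1 < x.1) _ hlt]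
  exact (Multiset.cons_le_cons_iff Δ).2
    (Multiset.monotone_filter_right k fun x hx => hlt.trans hx)

theorem usAux_le (n : Multiset Seg) (f : ℕ) : ∀ p : Seg,
    (usAux n f p : Multiset Seg) ≤ n.filter (fun x => p.1 < x.1) := by
  induction f with
  | zero => intro p; simp [usAux]
  | succ f ih =>
    intro p
    rw [usAux]
    rcases h2 : usNext n p with _ | Δ
    · simp
    · simp only
      obtain ⟨h3, h4⟩ := usNext_mem h2
      rw [← Multiset.cons_coe]
      exact ((Multiset.cons_le_cons_iff Δ).2 (ih Δ)).trans (cons_filter_le h3 h4.1)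

theorem usAux_fuel (n : Multiset Seg) (f : ℕ) : ∀ (p : Seg) (f' : ℕ),
    (n.filter (fun x => p.1 < x.1)).card ≤ f → (n.filter (fun x => p.1 < x.1)).card ≤ f' →
    usAux n f p = usAux n f' p := by
  induction f with
  | zero =>
    intro p f' h h'
    have h0 : n.filter (fun x => p.1 < x.1) = 0 := by simpa using h
    have := usAux_le n f' p
    rw [h0] at this
    have : usAux n f' p = [] := by simpa using this
    rw [this]; rfl
  | succ f ih =>
    intro p f' h h'
    rw [usAux]
    rcases h2 : usNext n p with _ | Δ
    · rcases f' with _ | f' <;> simp [usAux, h2]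
    · obtain ⟨h3, h4⟩ := usNext_mem h2
      have h5 := Multiset.card_le_card (cons_filter_le h3 h4.1)
      rw [Multiset.card_cons] at h5
      rcases f' with _ | f'
      · omega
      · rw [usAux, h2]
        simp only
        rw [ih Δ f' (by omega) (by omega)]

/-- The tail of an upward sequence, in the segments of `n`. -/
def chain (n : Multiset Seg) (p : Seg) : List Seg := usAux n n.card p

theorem chain_le (n : Multiset Seg) (p : Seg) :
    (chain n p : Multiset Seg) ≤ n.filter (fun x => p.1 < x.1) := usAux_le _ _ _

theorem chain_congr {n n' : Multiset Seg} {p : Seg}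
    (h : n.filter (fun Δ => p.1 < Δ.1) = n'.filter (fun Δ => p.1 < Δ.1)) :
    chain n p = chain n' p := by
  unfold chain
  rw [usAux_congr _ n n' p h]
  apply usAux_fuel
  · rw [← h]; exact Multiset.card_le_card (Multiset.filter_le _ _)
  · exact Multiset.card_le_card (Multiset.filter_le _ _)

theorem chain_unfold (n : Multiset Seg) (p : Seg) :
    chain n p = match usNext n p with
      | none => []
      | some Δ => Δ :: chain n Δ := by
  have : chain n p = usAux n (n.card + 1) p := by
    apply usAux_fuel
    · exact Multiset.card_le_card (Multiset.filter_le _ _)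
    · exact (Multiset.card_le_card (Multiset.filter_le _ _)).trans (Nat.le_succ _)
  rw [this, usAux]
  rfl

theorem chain_nil {n : Multiset Seg} {p : Seg} (h : ∀ Δ ∈ n, ¬ Prec p Δ) : chain n p = [] := by
  rw [chain_unfold, usNext_eq_none h]

theorem chain_match {n : Multiset Seg} {t y z : ℤ} (hz : (t + 1, z) ∈ n)
    (hmax : ∀ w ∈ ends n (t + 1), w ≤ z) (hty : t ≤ y) (hyz : y < z) :
    chain n (t, y) = (t + 1, z) :: chain n (t + 1, z) := by
  rw [chain_unfold]
  have : usNext n (t, y) = some (t + 1, z) := by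
    unfold usNext
    have h1 : msetMin ((n.filter fun Δ => Prec (t, y) Δ).map Prod.fst) = some (t + 1) := by
      rw [msetMin_eq_some]
      constructor
      · simp only [Multiset.mem_map, Multiset.mem_filter]
        exact ⟨(t + 1, z), ⟨hz, by unfold Prec; simp only; omega⟩, rfl⟩
      · intro x hx
        simp only [Multiset.mem_map, Multiset.mem_filter] at hx
        obtain ⟨Δ, ⟨_, h, _⟩, rfl⟩ := hx
        omega
    rw [h1]
    simp only [Option.map_eq_some_iff]
    refine ⟨z, ?_, rfl⟩
    rw [msetMax_eq_some]
    constructor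
    · simp only [Multiset.mem_map, Multiset.mem_filter]
      exact ⟨(t + 1, z), ⟨⟨hz, by unfold Prec; simp only; omega⟩, rfl⟩, rfl⟩
    · intro x hx
      simp only [Multiset.mem_map, Multiset.mem_filter] at hx
      obtain ⟨⟨p, q⟩, ⟨⟨h1, _⟩, h2⟩, rfl⟩ := hx
      simp only at h2
      subst h2
      exact hmax _ (mem_ends.2 h1)
  rw [this]

theorem chain_skip {n : Multiset Seg} {t y : ℤ} (hmax : ∀ w ∈ ends n (t + 1), w ≤ y) :
    chain n (t, y) = chain n (t + 1, y) := by
  rw [chain_unfold, chain_unfold]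
  have : usNext n (t, y) = usNext n (t + 1, y) := by
    apply usNext_congr
    apply Multiset.filter_congr
    rintro ⟨p, q⟩ hx
    simp only [Prec]
    constructor
    · rintro ⟨h1, h2, h3⟩
      refine ⟨?_, h2, h3⟩
      by_contra h
      have : p = t + 1 := by omega
      subst this
      have := hmax q (mem_ends.2 hx)
      omega
    · rintro ⟨h1, h2, h3⟩
      exact ⟨by omega, h2, h3⟩
  rw [this]

/-! ### The multisegment `𝔡(m)` -/

theorem usList_eq {n : Multiset Seg} {t y : ℤ} (h1 : (t, y) ∈ n) (h2 : ∀ Δ ∈ n, t ≤ Δ.1)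
    (h3 : ∀ w ∈ ends n t, w ≤ y) : usList n = (t, y) :: chain n (t, y) := by
  unfold usList
  have e1 : msetMin (n.map Prod.fst) = some t := by
    rw [msetMin_eq_some]
    constructor
    · exact Multiset.mem_map.2 ⟨_, h1, rfl⟩
    · intro x hx
      obtain ⟨Δ, h, rfl⟩ := Multiset.mem_map.1 hx
      exact h2 Δ h
  have e2 : longStart n t = some (t, y) := by
    unfold longStart
    have : msetMax ((startAt n t).map Prod.snd) = some y :=
      msetMax_eq_some.2 ⟨mem_ends.2 h1, h3⟩
    rw [this]; rfl
  rw [e1]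
  simp only
  rw [e2]
  rfl

theorem exists_first {n : Multiset Seg} (hn : n ≠ 0) : ∃ t y : ℤ, (t, y) ∈ n ∧
    (∀ Δ ∈ n, t ≤ Δ.1) ∧ ∀ w ∈ ends n t, w ≤ y := by
  rcases ht : msetMin (n.map Prod.fst) with _ | t
  · exact absurd (by simpa using msetMin_eq_none.1 ht) hn
  obtain ⟨h1, h2⟩ := msetMin_eq_some.1 ht
  obtain ⟨⟨p, q⟩, h3, h4⟩ := Multiset.mem_map.1 h1
  simp only at h4
  subst h4
  rcases hy : msetMax (ends n p) with _ | y
  · have := mem_ends.2 h3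
    rw [msetMax_eq_none.1 hy] at this
    simp at this
  obtain ⟨h5, h6⟩ := msetMax_eq_some.1 hy
  exact ⟨p, y, mem_ends.1 h5, fun Δ hΔ => h2 _ (Multiset.mem_map_of_mem _ hΔ), h6⟩

theorem card_sub_usList {n : Multiset Seg} (hn : n ≠ 0) :
    (n - (usList n : Multiset Seg)).card < n.card := by
  obtain ⟨t, y, h1, h2, h3⟩ := exists_first hn
  rw [usList_eq h1 h2 h3, ← Multiset.cons_coe, Multiset.sub_cons]
  exact lt_of_le_of_lt (Multiset.card_le_card (Multiset.sub_le_self _ _))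
    (Multiset.card_erase_lt_of_mem h1)

theorem usDecomp_fuel (f : ℕ) : ∀ (n : Multiset Seg) (f' : ℕ), n.card ≤ f → n.card ≤ f' →
    usDecomp f n = usDecomp f' n := by
  induction f with
  | zero =>
    intro n f' h h'
    have : n = 0 := by simpa using h
    subst this
    rcases f' with _ | f' <;> simp [usDecomp]
  | succ f ih =>
    intro n f' h h'
    by_cases hn : n = 0
    · subst hn
      rcases f' with _ | f' <;> simp [usDecomp]
    · have hc := card_sub_usList hn
      rcases f' with _ | f'
      · exact absurd (by simpa using h') hn
      · rw [usDecomp, usDecomp, if_neg hn, if_neg hn, ih _ f' (by omega) (by omega)]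

theorem foldl_nf (l : List (List Seg)) : ∀ x : Multiset Seg,
    l.foldl (fun acc row => acc + nfRow row) x
      = x + l.foldl (fun acc row => acc + nfRow row) 0 := by
  induction l with
  | nil => simp
  | cons r l ih =>
    intro x
    rw [List.foldl_cons, List.foldl_cons, ih, ih (0 + nfRow r)]
    simp [add_assoc]

@[simp] theorem frakd_zero : frakd 0 = 0 := rfl

theorem frakd_unfold {n : Multiset Seg} (hn : n ≠ 0) :
    frakd n = nfRow (usList n) + frakd (n - (usList n : Multiset Seg)) := by
  have hc := card_sub_usList hn
  unfold frakd
  rw [usDecomp_fuel n.card n ((n.card - 1) + 1) le_rfl (by omega), usDecomp, if_neg hn,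
    List.foldl_cons, foldl_nf, zero_add,
    usDecomp_fuel (n.card - 1) _ (n - (usList n : Multiset Seg)).card (by omega) le_rfl]

/-- Removing the first row. -/
theorem frakd_row {n Z : Multiset Seg} {t y : ℤ} (h2 : ∀ Δ ∈ n, t ≤ Δ.1)
    (h3 : ∀ w ∈ ends n t, w ≤ y)
    (hZ : Z.filter (fun x => t < x.1) = n.filter fun x => t < x.1) :
    frakd ((t, y) ::ₘ n) = nfRow ((t, y) :: chain Z (t, y))
      + frakd (n - (chain Z (t, y) : Multiset Seg)) := by
  have hu : usList ((t, y) ::ₘ n) = (t, y) :: chain Z (t, y) := by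
    rw [usList_eq (t := t) (y := y)]
    · congr 1
      apply chain_congr
      rw [hZ, Multiset.filter_cons_of_neg]
      simp
    · simp
    · intro Δ hΔ
      rcases Multiset.mem_cons.1 hΔ with rfl | h
      · exact le_rfl
      · exact h2 Δ h
    · rw [ends_cons_self]
      intro w hw
      rcases Multiset.mem_cons.1 hw with rfl | h
      · exact le_rfl
      · exact h3 w h
  rw [frakd_unfold (Multiset.cons_ne_zero), hu, ← Multiset.cons_coe, Multiset.sub_cons,
    Multiset.erase_cons_head]

theorem nfRow_start (t y : ℤ) (t' : ℤ) (l : List Seg) :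
    nfRow ((t, y) :: l) = nfRow ((t', y) :: l) := by
  rcases l with _ | ⟨Δ, l⟩ <;> rfl

theorem ends_sub_chain {Y : Multiset Seg} {L : Multiset Seg} {i : ℤ} (hL : L ≤ Y)
    (h : ∀ Δ ∈ L, Δ.1 ≠ i) : ends (Y - L) i = ends Y i := by
  conv_rhs => rw [← tsub_add_cancel_of_le hL]
  rw [ends_add, ends_eq_zero h, add_zero]

theorem filter_eq_self_of {Y : Multiset Seg} {t : ℤ} (h : ∀ Δ ∈ Y, t + 1 ≤ Δ.1) :
    Y.filter (fun x => t < x.1) = Y :=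
  Multiset.filter_eq_self.2 fun Δ hΔ => by have := h Δ hΔ; omega

theorem filter_map_mk {A : Multiset ℤ} {t s : ℤ} (h : s ≤ t) :
    (A.map (Prod.mk s)).filter (fun x : Seg => t < x.1) = 0 := by
  apply Multiset.filter_eq_nil.2
  intro Δ hΔ
  obtain ⟨x, _, rfl⟩ := Multiset.mem_map.1 hΔ
  simpa using h

/-- The key recursion for `𝔡`. -/
theorem frakd_key (t : ℤ) (A : Multiset ℤ) : ∀ (Y : Multiset Seg) (M U : Multiset ℤ),
    IsMS (A.map (Prod.mk t) + Y) → (∀ Δ ∈ Y, t + 1 ≤ Δ.1) → gu A (ends Y (t + 1)) = U →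
    A = M + U →
    frakd (A.map (Prod.mk t) + Y) = M.map (Prod.mk t) + frakd (Y + pr t U) := by
  induction A using max_induction with
  | h0 =>
    intro Y M U _ _ _ hMU
    have h1 : M = 0 ∧ U = 0 := by simpa using hMU.symm
    simp [h1.1, h1.2, pr]
  | hs y A hA ih =>
    intro Y M U hms hY hU hMU
    have hty : t ≤ y := hms (t, y) (by simp)
    have hmsA : ∀ x ∈ A, t ≤ x := fun x hx => hms (t, x) (by simp [hx])
    have hmsY : ∀ Δ ∈ Y, Δ.1 ≤ Δ.2 := fun x hx => hms x (by simp [hx])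
    have hrow : frakd ((y ::ₘ A).map (Prod.mk t) + Y) = nfRow ((t, y) :: chain Y (t, y))
        + frakd (A.map (Prod.mk t) + Y - (chain Y (t, y) : Multiset Seg)) := by
      rw [Multiset.map_cons, Multiset.cons_add]
      apply frakd_row
      · intro Δ hΔ
        rcases Multiset.mem_add.1 hΔ with h | h
        · obtain ⟨x, _, rfl⟩ := Multiset.mem_map.1 h
          exact le_rfl
        · have := hY Δ h; omega
      · rw [ends_add, ends_map_self, ends_eq_zero (m := Y), add_zero]
        · exact hA
        · intro Δ hΔ
          have := hY Δ hΔ; omega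
      · rw [Multiset.filter_add, filter_map_mk le_rfl, zero_add]
    have hLY : (chain Y (t, y) : Multiset Seg) ≤ Y :=
      (chain_le Y (t, y)).trans (Multiset.filter_le _ _)
    rw [hrow, add_tsub_assoc_of_le hLY]
    have hms' : IsMS (A.map (Prod.mk t) + (Y - (chain Y (t, y) : Multiset Seg))) := by
      apply hms.mono
      rw [Multiset.map_cons, Multiset.cons_add]
      exact (add_le_add_right (Multiset.sub_le_self _ _) _).trans (Multiset.le_cons_self _ _)
    have hY' : ∀ Δ ∈ Y - (chain Y (t, y) : Multiset Seg), t + 1 ≤ Δ.1 := fun Δ hΔ =>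
      hY Δ (Multiset.mem_of_le (Multiset.sub_le_self _ _) hΔ)
    rcases max_cases (ends Y (t + 1)) y with hB | ⟨z, B', hzB, hz, hyz⟩
    · skip
      rw [gu_skip hA hB] at hU
      have hch := chain_skip hB
      have hL2 := chain_le Y (t + 1, y)
      rw [← hch] at hL2
      have hends : ends (Y - (chain Y (t, y) : Multiset Seg)) (t + 1) = ends Y (t + 1) := by
        apply ends_sub_chain hLY
        intro Δ hΔ
        have := (Multiset.mem_filter.1 (Multiset.mem_of_le hL2 hΔ)).2
        simp only at this
        omega
      have hMA : A = M + gu A (ends Y (t + 1)) := by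
        rw [← hU, Multiset.add_cons, Multiset.cons_inj_right] at hMU
        exact hMU
      rw [ih _ M (gu A (ends Y (t + 1))) hms' hY' (by rw [hends]) hMA, ← hU, pr_cons]
      by_cases hlt : t < y
      · have e1 : pr t {y} = {(t + 1, y)} := by
          unfold pr; rw [Multiset.filter_singleton, if_pos hlt]; simp
        have e2 : Y + (pr t {y} + pr t (gu A (ends Y (t + 1))))
            = (t + 1, y) ::ₘ (Y + pr t (gu A (ends Y (t + 1)))) := by
          rw [e1, ← Multiset.singleton_add]; abel
        rw [e2, frakd_row (Z := Y), ← hch, nfRow_start t y (t + 1),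
          tsub_add_eq_add_tsub hLY]
        · abel
        · intro Δ hΔ
          rcases Multiset.mem_add.1 hΔ with h | h
          · exact hY Δ h
          · obtain ⟨x, _, rfl⟩ := Multiset.mem_map.1 h
            exact le_rfl
        · rw [ends_add, ends_pr]
          intro w hw
          rcases Multiset.mem_add.1 hw with h | h
          · exact hB w h
          · exact hA w (Multiset.mem_of_le (gu_le _ _) (Multiset.mem_filter.1 h).1)
        · rw [Multiset.filter_add, pr, filter_map_mk le_rfl, add_zero]
      · have e1 : pr t {y} = 0 := by
          unfold pr; rw [Multiset.filter_singleton, if_neg hlt]; simp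
        have e2 : chain Y (t, y) = [] := by
          apply chain_nil
          rintro ⟨p, q⟩ hx ⟨h1, h2, h3⟩
          simp only at h1 h2 h3
          have : p = t + 1 := by omega
          subst this
          have := hB q (mem_ends.2 hx)
          omega
        rw [e1, e2]
        simp [nfRow]
    · skip
      rw [hzB, gu_match hA hz hyz] at hU
      have hzY : (t + 1, z) ∈ Y := mem_ends.1 (by rw [hzB]; simp)
      have hch := chain_match (n := Y) (t := t) (y := y) (z := z) hzY
        (by rw [hzB]; simpa using hz) hty hyz
      obtain ⟨Y', rfl⟩ := Multiset.exists_cons_of_mem hzY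
      have hBY' : ends Y' (t + 1) = B' := by
        rw [ends_cons_self, Multiset.cons_inj_right] at hzB
        exact hzB
      have hch2 : chain ((t + 1, z) ::ₘ Y') (t + 1, z) = chain Y' (t + 1, z) := by
        apply chain_congr
        rw [Multiset.filter_cons_of_neg]
        simp
      rw [hch2] at hch
      have hL2 := chain_le Y' (t + 1, z)
      have hL2' := hL2.trans (Multiset.filter_le _ _)
      have hsub : (t + 1, z) ::ₘ Y' - (chain ((t + 1, z) ::ₘ Y') (t, y) : Multiset Seg)
          = Y' - (chain Y' (t + 1, z) : Multiset Seg) := by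
        rw [hch, ← Multiset.cons_coe, Multiset.sub_cons, Multiset.erase_cons_head]
      rw [hsub] at hms' hY' ⊢
      have hends : ends (Y' - (chain Y' (t + 1, z) : Multiset Seg)) (t + 1) = B' := by
        rw [ends_sub_chain hL2', hBY']
        intro Δ hΔ
        have := (Multiset.mem_filter.1 (Multiset.mem_of_le hL2 hΔ)).2
        simp only at this
        omega
      have hUA : U ≤ A := by rw [← hU]; exact gu_le _ _
      obtain ⟨M', hM'⟩ := Multiset.le_iff_exists_add.1 hUA
      have hMM : M = y ::ₘ M' := by
        rw [hM', add_comm U, ← Multiset.cons_add] at hMU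
        exact (add_right_cancel hMU).symm
      rw [ih _ M' U hms' hY' (by rw [hends, hU]) (by rw [hM', add_comm]), hch,
        Multiset.cons_add, frakd_row (Z := Y')]
      · have e3 : nfRow ((t, y) :: (t + 1, z) :: chain Y' (t + 1, z))
            = nfRow ((t + 1, z) :: chain Y' (t + 1, z)) + {(t, y)} := by
          rw [nfRow, pushSeg, if_pos (by simp only; omega)]
          simp
        rw [e3, hMM, Multiset.map_cons, ← Multiset.singleton_add, tsub_add_eq_add_tsub hL2']
        abel
      · intro Δ hΔ
        rcases Multiset.mem_add.1 hΔ with h | h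
        · exact hY Δ (Multiset.mem_cons_of_mem h)
        · obtain ⟨x, _, rfl⟩ := Multiset.mem_map.1 h
          exact le_rfl
      · rw [ends_add, ends_pr, hBY']
        intro w hw
        rcases Multiset.mem_add.1 hw with h | h
        · exact hz w h
        · have := hA w (Multiset.mem_of_le hUA (Multiset.mem_filter.1 h).1)
          omega
      · rw [Multiset.filter_add, pr, filter_map_mk le_rfl, add_zero]

/-! ### Main induction -/

theorem hdComp_eq (k : ℕ) : ∀ (t : ℤ) (X m : Multiset Seg), IsMS (X + m) →
    (∀ Δ ∈ X, Δ.1 < t) → (∀ Δ ∈ m, t ≤ Δ.1) → (∀ Δ ∈ m, Δ.2 < t + k) →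
    hdComp k t (X + m) = some (X + frakd m) := by
  induction k with
  | zero =>
    intro t X m hms _ h1 h2
    have : m = 0 := by
      refine Multiset.eq_zero_of_forall_notMem fun Δ hΔ => ?_
      have a1 := h1 Δ hΔ
      have a2 := h2 Δ hΔ
      have a3 := hms Δ (by simp [hΔ])
      simp at a2
      omega
    subst this
    simp [hdComp]
  | succ k ih =>
    intro t X m hms hX h1 h2
    set A := ends m t with hA
    set Y := m.filter (fun Δ => ¬ Δ.1 = t) with hYdef
    have hm : m = A.map (Prod.mk t) + Y := by
      rw [hA, ← startAt_eq, startAt, hYdef, Multiset.filter_add_not]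
    have hY : ∀ Δ ∈ Y, t + 1 ≤ Δ.1 := by
      intro Δ hΔ
      obtain ⟨a1, a2⟩ := Multiset.mem_filter.1 hΔ
      have := h1 Δ a1
      omega
    obtain ⟨U, hU⟩ : ∃ U, gu A (ends Y (t + 1)) = U := ⟨_, rfl⟩
    obtain ⟨M, hM⟩ := Multiset.le_iff_exists_add.1 (hU ▸ gu_le A (ends Y (t + 1)))
    have hMU : A = M + U := by rw [hM, add_comm]
    have hA' : ends (X + m) t = A := by
      rw [ends_add, ends_eq_zero (m := X), zero_add]
      intro Δ hΔ
      have := hX Δ hΔ; omega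
    have hB' : ends (X + m) (t + 1) = ends Y (t + 1) := by
      rw [ends_add, ends_eq_zero (m := X), zero_add]
      · conv_lhs => rw [hm]
        rw [ends_add, ends_map_ne _ (by omega), zero_add]
      · intro Δ hΔ
        have := hX Δ hΔ; omega
    have hD : DrhoPow t (epsA t (X + m)) (X + m)
        = some (X + M.map (Prod.mk t) + Y + pr t U) := by
      apply DrhoPow_eq t _ _ _ _ hms
      · rw [hm, hMU, Multiset.map_add]; abel
      · rw [hA', hB', hU]
      · rw [epsA_eq t hms, hA', hB', hU]
    have hUm : ∀ u ∈ U, (t, u) ∈ m := by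
      intro u hu
      rw [hm, hMU]
      simp [hu]
    have hMm : ∀ u ∈ M, (t, u) ∈ m := by
      intro u hu
      rw [hm, hMU]
      simp [hu]
    have hYm : ∀ Δ ∈ Y, Δ ∈ m := fun Δ h => (Multiset.mem_filter.1 h).1
    have hpr : ∀ Δ ∈ pr t U, Δ.1 = t + 1 ∧ t < Δ.2 ∧ (t, Δ.2) ∈ m := by
      intro Δ hΔ
      obtain ⟨x, hx, rfl⟩ := Multiset.mem_map.1 hΔ
      obtain ⟨a1, a2⟩ := Multiset.mem_filter.1 hx
      exact ⟨rfl, a2, hUm x a1⟩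
    rw [hdComp, hD]
    simp only
    rw [add_assoc, ih (t + 1) (X + M.map (Prod.mk t)) (Y + pr t U)]
    · conv_rhs => rw [hm, frakd_key t A Y M U (by rw [← hm]; exact hms.mono (by simp)) hY hU hMU]
      rw [add_assoc]
    · intro Δ hΔ
      rcases Multiset.mem_add.1 hΔ with h | h
      · rcases Multiset.mem_add.1 h with h | h
        · exact hms Δ (by simp [h])
        · obtain ⟨x, hx, rfl⟩ := Multiset.mem_map.1 h
          exact hms _ (by simp [hMm x hx])
      · rcases Multiset.mem_add.1 h with h | h
        · exact hms Δ (by simp [hYm Δ h])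
        · have := hpr Δ h
          omega
    · intro Δ hΔ
      rcases Multiset.mem_add.1 hΔ with h | h
      · have := hX Δ h; omega
      · obtain ⟨x, hx, rfl⟩ := Multiset.mem_map.1 h
        simp
    · intro Δ hΔ
      rcases Multiset.mem_add.1 hΔ with h | h
      · exact hY Δ h
      · exact (hpr Δ h).1.ge
    · intro Δ hΔ
      rcases Multiset.mem_add.1 hΔ with h | h
      · have := h2 Δ (hYm Δ h)
        push_cast at this
        omega
      · have := h2 _ (hpr Δ h).2.2
        push_cast at this
        omega

/-- the iterated `ρ`-derivatives
`(𝒟_{[b]})^{ε_b} ∘ ⋯ ∘ (𝒟_{[a]})^{ε_a}(m)` (exponents computed stagewise) are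
all nonzero and compute `𝔡(m)`. -/
theorem stmt19 (m : Multiset Seg) (hm : IsMS m) (hne : m ≠ 0)
    (a b : ℤ) (ha : msetMin (m.map Prod.fst) = some a)
    (hb : msetMax (m.map Prod.snd) = some b) :
    hdComp (b - a + 1).toNat a m = some (frakd m) := by
  obtain ⟨ha1, ha2⟩ := msetMin_eq_some.1 ha
  obtain ⟨hb1, hb2⟩ := msetMax_eq_some.1 hb
  have h := hdComp_eq (b - a + 1).toNat a 0 m (by simpa using hm) (by simp)
    (fun Δ hΔ => ha2 _ (Multiset.mem_map_of_mem _ hΔ)) (by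
      intro Δ hΔ
      have h1 := hb2 _ (Multiset.mem_map_of_mem Prod.snd hΔ)
      omega)
  simpa using h

end Multiseg
end
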